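/- arXiv:1005.2893 — 9 statements merged into one kernel-verified Lean document; each statement's English description precedes it below -/
import Mathlib

section
/- Let (E, ℰ, μ) be a measure space and let f : E → ℝ be measurable. Assume there are reals S > 0 and V > 0 with |f(x)| ≤ S for all x ∈ E and ∫_E f² dμ = V < ∞. Let X be a real random variable on a probability space (Ω, 𝔉, ℙ) whose moment generating function satisfies, for every λ ∈ ℝ, 𝔼[exp(λX)] = exp( ∫_E ( exp(λ f(x)) − 1 − λ f(x) ) μ(dx) ). Then for every ξ > 0, ℙ(|X| ≥ ξ) ≤ 2 exp( −3ξ² / (2Sξ + 6V) ). -/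
open MeasureTheory

/-- The Bernstein bound on the second-order remainder of the exponential. -/
lemma Real.exp_sub_one_sub_le_of_abs_le {z b : ℝ} (hz : |z| ≤ b) (hb : b < 3) :
    Real.exp z - 1 - z ≤ z ^ 2 / (2 * (1 - b / 3)) := by
  have hb0 : 0 ≤ b := (abs_nonneg z).trans hz
  have hexp : HasSum (fun n : ℕ => z ^ n / (n.factorial : ℝ)) (Real.exp z) := by
    rw [Real.exp_eq_exp_ℝ]
    exact NormedSpace.expSeries_div_hasSum_exp z
  have htail : HasSum (fun n : ℕ => z ^ (n + 2) / ((n + 2).factorial : ℝ))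
      (Real.exp z - 1 - z) := by
    have h := (hasSum_nat_add_iff' 2).mpr hexp
    simpa [Finset.sum_range_succ, sub_sub] using h
  have hgeom : HasSum (fun n : ℕ => z ^ 2 / 2 * (b / 3) ^ n)
      (z ^ 2 / 2 * (1 - b / 3)⁻¹) :=
    (hasSum_geometric_of_lt_one (by positivity) (by linarith)).mul_left _
  have hle : ∀ n : ℕ,
      z ^ (n + 2) / ((n + 2).factorial : ℝ) ≤ z ^ 2 / 2 * (b / 3) ^ n := by
    intro n
    have hfac : (2 * 3 ^ n : ℝ) ≤ ((n + 2).factorial : ℝ) := by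
      have h := @Nat.factorial_mul_pow_le_factorial 2 n
      rw [add_comm 2 n] at h
      exact_mod_cast h
    have hpow : z ^ n ≤ b ^ n :=
      (le_abs_self _).trans ((abs_pow z n).le.trans (pow_le_pow_left₀ (abs_nonneg z) hz n))
    calc z ^ (n + 2) / ((n + 2).factorial : ℝ)
        ≤ z ^ 2 * b ^ n / ((n + 2).factorial : ℝ) := by
          rw [pow_add, mul_comm]
          gcongr
      _ ≤ z ^ 2 * b ^ n / (2 * 3 ^ n) := by gcongr
      _ = z ^ 2 / 2 * (b / 3) ^ n := by
          rw [div_pow]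
          field_simp
  refine (hasSum_le hle htail hgeom).trans_eq ?_
  rw [← div_eq_mul_inv, div_div]

/-- The exponent of a compensated Poisson integral is at most a Bernstein-type quadratic. -/
lemma integral_exp_sub_one_sub_le {E : Type*} [MeasurableSpace E] {μ : Measure E}
    {f : E → ℝ} {S l : ℝ} (hfS : ∀ x, |f x| ≤ S)
    (hf2 : Integrable (fun x => f x ^ 2) μ)
    (hint : Integrable (fun x => Real.exp (l * f x) - 1 - l * f x) μ)
    (hl : |l| * S < 3) :
    ∫ x, (Real.exp (l * f x) - 1 - l * f x) ∂μ
      ≤ l ^ 2 / (2 * (1 - |l| * S / 3)) * ∫ x, f x ^ 2 ∂μ := by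
  rw [← integral_const_mul]
  refine integral_mono hint (hf2.const_mul _) fun x => ?_
  have hz : |l * f x| ≤ |l| * S := by
    rw [abs_mul]
    exact mul_le_mul_of_nonneg_left (hfS x) (abs_nonneg l)
  refine (Real.exp_sub_one_sub_le_of_abs_le hz hl).trans_eq ?_
  rw [mul_pow, div_mul_eq_mul_div]

/-- Bernstein-type inequality for a random variable whose moment generating function
is that of a compensated Poisson integral `∫ f dM*` with intensity `μ`. -/
theorem stmt0 {E : Type*} [MeasurableSpace E] (μ : Measure E)
    {Ω : Type*} [MeasurableSpace Ω] (ℙ : Measure Ω) [IsProbabilityMeasure ℙ]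
    (f : E → ℝ) (hf : Measurable f) (S V : ℝ) (hS : 0 < S) (hV : 0 < V)
    (hfS : ∀ x, |f x| ≤ S)
    (hf2int : Integrable (fun x => f x ^ 2) μ)
    (hf2 : ∫ x, f x ^ 2 ∂μ = V)
    (X : Ω → ℝ) (hX : Measurable X)
    (hint : ∀ lam : ℝ, Integrable (fun ω => Real.exp (lam * X ω)) ℙ)
    (hint' : ∀ lam : ℝ,
      Integrable (fun x => Real.exp (lam * f x) - 1 - lam * f x) μ)
    (hmgf : ∀ lam : ℝ, ∫ ω, Real.exp (lam * X ω) ∂ℙ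
      = Real.exp (∫ x, (Real.exp (lam * f x) - 1 - lam * f x) ∂μ)) :
    ∀ ξ : ℝ, 0 < ξ →
      ℙ {ω | ξ ≤ |X ω|} ≤
        ENNReal.ofReal (2 * Real.exp (-(3 * ξ ^ 2) / (2 * S * ξ + 6 * V))) := by
  intro ξ hξ
  set l : ℝ := 3 * ξ / (3 * V + S * ξ) with hl
  have hD : 0 < 3 * V + S * ξ := by positivity
  have hl0 : 0 < l := by positivity
  have hlS : l * S < 3 := by
    rw [hl, div_mul_eq_mul_div, div_lt_iff₀ hD]
    nlinarith
  have hexponent : -l * ξ + l ^ 2 / (2 * (1 - l * S / 3)) * V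
      = -(3 * ξ ^ 2) / (2 * S * ξ + 6 * V) := by
    have h1 : 1 - l * S / 3 = 3 * V / (3 * V + S * ξ) := by
      rw [hl]
      field_simp
      ring
    have h2 : 2 * S * ξ + 6 * V = 2 * (3 * V + S * ξ) := by ring
    rw [h1, h2, hl]
    field_simp
    ring
  have hbound : ∀ t : ℝ, |t| = l →
      Real.exp (-l * ξ) * ProbabilityTheory.mgf X ℙ t
        ≤ Real.exp (-(3 * ξ ^ 2) / (2 * S * ξ + 6 * V)) := by
    intro t ht
    have h := integral_exp_sub_one_sub_le hfS hf2int (hint' t) (by rwa [ht])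
    rw [ht, hf2, ← sq_abs, ht] at h
    rw [ProbabilityTheory.mgf, hmgf, ← Real.exp_add, ← hexponent]
    gcongr
  have hupper : ℙ.real {ω | ξ ≤ X ω}
      ≤ Real.exp (-(3 * ξ ^ 2) / (2 * S * ξ + 6 * V)) :=
    (ProbabilityTheory.measure_ge_le_exp_mul_mgf ξ hl0.le (hint l)).trans
      (hbound l (abs_of_pos hl0))
  have hlower : ℙ.real {ω | X ω ≤ -ξ}
      ≤ Real.exp (-(3 * ξ ^ 2) / (2 * S * ξ + 6 * V)) := by
    refine (ProbabilityTheory.measure_le_le_exp_mul_mgf (-ξ) (neg_nonpos.mpr hl0.le)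
      (hint (-l))).trans ?_
    rw [neg_neg, mul_neg, ← neg_mul]
    exact hbound (-l) (by rw [abs_neg, abs_of_pos hl0])
  have hset : {ω | ξ ≤ |X ω|} = {ω | ξ ≤ X ω} ∪ {ω | X ω ≤ -ξ} := by
    ext ω
    simp [le_abs, le_neg]
  rw [ENNReal.le_ofReal_iff_toReal_le (measure_ne_top _ _) (by positivity), hset]
  refine (measureReal_union_le _ _).trans ?_
  rw [two_mul]
  exact add_le_add hupper hlower
end

section
/- Let ρ₁ and ρ₂ be Borel measures on the interval (0,1] such that ρ_i([w,1]) < ∞ for every w ∈ (0,1] and i ∈ {1,2}, such that ρ₂((0,1]) = ∞, and such that ρ₁([w,1]) / ρ₂([w,1]) → 1 as w → 0⁺. Then for every gauge function g, ∫_{(0,1]} g(r) ρ₁(dr) = ∞ if and only if ∫_{(0,1]} g(r) ρ₂(dr) = ∞. -/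
open MeasureTheory Filter Set

/-- A gauge function: nondecreasing on `[0,∞)`, vanishing (with limit zero) at `0`,
and such that `r ↦ g r / r` is positive and nonincreasing on `(0,1]`. -/
def IsGauge (g : ℝ → ℝ) : Prop :=
  MonotoneOn g (Set.Ici 0) ∧ g 0 = 0 ∧
    Tendsto g (nhdsWithin 0 (Set.Ioi 0)) (nhds 0) ∧
    (∀ r ∈ Set.Ioc (0 : ℝ) 1, 0 < g r / r) ∧
    AntitoneOn (fun r => g r / r) (Set.Ioc (0 : ℝ) 1)

/-- A comparison of the tails `[w,1]` for small `w` passes, up to an additive constant,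
to every subset of `(0,1]` that is upward closed in `(0,1]`. -/
theorem measure_le_of_tail_le {μ ν : Measure ℝ} {w₀ : ℝ} {c : ENNReal}
    (h : ∀ w ∈ Set.Ioc 0 w₀, μ (Set.Icc w 1) ≤ c * ν (Set.Icc w 1)) {s : Set ℝ}
    (hs : s ⊆ Set.Ioc 0 1) (hup : ∀ w ∈ s, Set.Icc w 1 ⊆ s) :
    μ s ≤ c * ν s + μ (Set.Icc w₀ 1) := by
  have key : ∀ w ∈ s, μ (Set.Icc w 1) ≤ c * ν s + μ (Set.Icc w₀ 1) := by
    intro w hw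
    rcases le_total w w₀ with hle | hle
    · exact (h w ⟨(hs hw).1, hle⟩).trans
        ((mul_le_mul_right (measure_mono (hup w hw)) c).trans le_self_add)
    · exact (measure_mono (Set.Icc_subset_Icc_left hle)).trans le_add_self
  rcases s.eq_empty_or_nonempty with rfl | hne
  · simp
  have hbdd : BddBelow s := ⟨0, fun x hx => (hs hx).1.le⟩
  have hglb : IsGLB s (sInf s) := isGLB_csInf hne hbdd
  by_cases hmem : sInf s ∈ s
  · have hsub : s ⊆ Set.Icc (sInf s) 1 := fun x hx => ⟨hglb.1 hx, (hs hx).2⟩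
    exact (measure_mono hsub).trans (key _ hmem)
  · obtain ⟨u, hanti, -, hlim, hu⟩ := hglb.exists_seq_strictAnti_tendsto_of_notMem hmem hne
    have hcover : s ⊆ ⋃ n, Set.Icc (u n) 1 := by
      intro x hx
      have hlt : sInf s < x := lt_of_le_of_ne (hglb.1 hx) fun he => hmem (he ▸ hx)
      obtain ⟨n, hn⟩ := (hlim.eventually (gt_mem_nhds hlt)).exists
      exact Set.mem_iUnion.2 ⟨n, hn.le, (hs hx).2⟩
    have hmono : Monotone fun n => Set.Icc (u n) 1 :=
      fun m n hmn => Set.Icc_subset_Icc_left (hanti.antitone hmn)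
    refine (measure_mono hcover).trans ?_
    rw [hmono.measure_iUnion]
    exact iSup_le fun n => key _ (hu n)

/-- If the tails of `μ` near `0` are dominated by those of `ν`, then integrals over `(0,1]` of
nonnegative nondecreasing functions that are finite for `ν` are finite for `μ`. -/
theorem lintegral_ne_top_of_tail_le {μ ν : Measure ℝ} {w₀ : ℝ} {c : ENNReal} (hc : c ≠ ⊤)
    (hfin : μ (Set.Icc w₀ 1) ≠ ⊤)
    (h : ∀ w ∈ Set.Ioc 0 w₀, μ (Set.Icc w 1) ≤ c * ν (Set.Icc w 1)) {g : ℝ → ℝ}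
    (hmono : MonotoneOn g (Set.Ioc 0 1)) (hnonneg : ∀ r ∈ Set.Ioc (0 : ℝ) 1, 0 ≤ g r)
    (hν : ∫⁻ r in Set.Ioc (0 : ℝ) 1, ENNReal.ofReal (g r) ∂ν ≠ ⊤) :
    ∫⁻ r in Set.Ioc (0 : ℝ) 1, ENNReal.ofReal (g r) ∂μ ≠ ⊤ := by
  have cake : ∀ ρ : Measure ℝ, ∫⁻ r in Set.Ioc (0 : ℝ) 1, ENNReal.ofReal (g r) ∂ρ =
      ∫⁻ t in Set.Ioi (0 : ℝ), ρ ({r | t < g r} ∩ Set.Ioc 0 1) := by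
    intro ρ
    rw [lintegral_eq_lintegral_meas_lt _ (ae_restrict_of_forall_mem measurableSet_Ioc hnonneg)
      (aemeasurable_restrict_of_monotoneOn measurableSet_Ioc hmono)]
    simp only [Measure.restrict_apply' measurableSet_Ioc]
  rw [cake] at hν ⊢
  set K := μ (Set.Icc w₀ 1)
  have hle : ∀ t, μ ({r | t < g r} ∩ Set.Ioc 0 1) ≤
      c * ν ({r | t < g r} ∩ Set.Ioc 0 1) + (Set.Iio (g 1)).indicator (fun _ => K) t := by
    intro t
    by_cases ht : t < g 1
    · rw [Set.indicator_of_mem (show t ∈ Set.Iio (g 1) from ht)]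
      refine measure_le_of_tail_le h Set.inter_subset_right ?_
      rintro w ⟨hw, hw'⟩ x hx
      have hx' : x ∈ Set.Ioc (0 : ℝ) 1 := ⟨hw'.1.trans_le hx.1, hx.2⟩
      exact ⟨lt_of_lt_of_le hw (hmono hw' hx' hx.1), hx'⟩
    · have hempty : {r | t < g r} ∩ Set.Ioc 0 1 = ∅ := by
        ext r
        simp only [Set.mem_inter_iff, Set.mem_ofPred_eq, Set.mem_empty_iff_false, iff_false]
        rintro ⟨hr, hr'⟩
        exact ht (hr.trans_le (hmono hr' ⟨one_pos, le_rfl⟩ hr'.2))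
      simp [hempty]
  refine ne_top_of_le_ne_top ?_ (lintegral_mono hle)
  rw [lintegral_add_right _ (measurable_const.indicator measurableSet_Iio),
    lintegral_const_mul' _ _ hc, lintegral_indicator measurableSet_Iio, setLIntegral_const,
    Measure.restrict_apply measurableSet_Iio, Set.Iio_inter_Ioi, Real.volume_Ioo]
  finiteness

/-- If two measures on `(0,1]` have asymptotically equivalent tails `ρ₁([w,1]) ∼ ρ₂([w,1])`
as `w → 0⁺`, and `ρ₂` has infinite total mass, then for every gauge function `g` the
integrals `∫ g dρ₁` and `∫ g dρ₂` diverge simultaneously. -/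
theorem stmt3 (ρ₁ ρ₂ : Measure ℝ)
    (hfin₁ : ∀ w ∈ Set.Ioc (0 : ℝ) 1, ρ₁ (Set.Icc w 1) ≠ ⊤)
    (hfin₂ : ∀ w ∈ Set.Ioc (0 : ℝ) 1, ρ₂ (Set.Icc w 1) ≠ ⊤)
    (hinf : ρ₂ (Set.Ioc (0 : ℝ) 1) = ⊤)
    (hratio : Tendsto (fun w => (ρ₁ (Set.Icc w 1)).toReal / (ρ₂ (Set.Icc w 1)).toReal)
      (nhdsWithin 0 (Set.Ioi 0)) (nhds 1))
    (g : ℝ → ℝ) (hg : IsGauge g) :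
    (∫⁻ r in Set.Ioc (0 : ℝ) 1, ENNReal.ofReal (g r) ∂ρ₁ = ⊤) ↔
      (∫⁻ r in Set.Ioc (0 : ℝ) 1, ENNReal.ofReal (g r) ∂ρ₂ = ⊤) := by
  have hmono : MonotoneOn g (Set.Ioc 0 1) := hg.1.mono fun r hr => hr.1.le
  have hnonneg : ∀ r ∈ Set.Ioc (0 : ℝ) 1, 0 ≤ g r := fun r hr =>
    hg.2.1 ▸ hg.1 Set.self_mem_Ici hr.1.le hr.1.le
  have hev := hratio.eventually (Ioo_mem_nhds (show (1 / 2 : ℝ) < 1 by norm_num) one_lt_two)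
  obtain ⟨δ, hδ, hsub⟩ := mem_nhdsGT_iff_exists_Ioc_subset.1 hev
  have hδ' : 0 < min δ 1 := lt_min hδ one_pos
  have tails : ∀ w ∈ Set.Ioc 0 (min δ 1), ρ₁ (Set.Icc w 1) ≤ 2 * ρ₂ (Set.Icc w 1) ∧
      ρ₂ (Set.Icc w 1) ≤ 2 * ρ₁ (Set.Icc w 1) := by
    intro w hw
    have hw1 : w ∈ Set.Ioc (0 : ℝ) 1 := ⟨hw.1, hw.2.trans (min_le_right _ _)⟩
    obtain ⟨h1, h2⟩ : _ ∧ _ := hsub ⟨hw.1, hw.2.trans (min_le_left _ _)⟩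
    have hpos : 0 < (ρ₂ (Set.Icc w 1)).toReal := by
      refine lt_of_le_of_ne ENNReal.toReal_nonneg fun h0 => ?_
      rw [← h0, div_zero] at h1
      norm_num at h1
    rw [lt_div_iff₀ hpos] at h1
    rw [div_lt_iff₀ hpos] at h2
    have f1 := hfin₁ w hw1
    have f2 := hfin₂ w hw1
    constructor
    · rw [← ENNReal.toReal_le_toReal f1 (by finiteness), ENNReal.toReal_mul,
        ENNReal.toReal_ofNat]
      exact h2.le
    · rw [← ENNReal.toReal_le_toReal f2 (by finiteness), ENNReal.toReal_mul,
        ENNReal.toReal_ofNat]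
      linarith
  have hmem : min δ 1 ∈ Set.Ioc (0 : ℝ) 1 := ⟨hδ', min_le_right _ _⟩
  rw [← not_iff_not]
  exact ⟨lintegral_ne_top_of_tail_le ENNReal.ofNat_ne_top (hfin₂ _ hmem)
      (fun w hw => (tails w hw).2) hmono hnonneg,
    lintegral_ne_top_of_tail_le ENNReal.ofNat_ne_top (hfin₁ _ hmem)
      (fun w hw => (tails w hw).1) hmono hnonneg⟩
end

section
/- Work in ℝ^d with the Euclidean inner product ⟨·,·⟩ and Lebesgue measure ℒ^d. Let 𝔰 ∈ ℝ^d be a unit vector, and let (ρ_n, s_n)_{n≥1} be a sequence of pairs with ρ_n ∈ (0,∞), s_n a unit vector, and ⟨s_n, 𝔰⟩ ≠ 0 for every n. For t ∈ ℝ^d, set ξ_t(n) = (ρ_n − ⟨s_n, t⟩)/⟨s_n, 𝔰⟩. For t ∈ ℝ^d, δ ∈ (0,1) and an integer j ≥ 0, define Q_{t,δ,j} = { q ∈ {0,…,2^j−1} : q = ⌊(2^j/δ)|ξ_t(n)|⌋ for some integer n with 1 ≤ n ≤ ⌊2^j/δ⌋ }, and Q̲_{t,δ} = liminf_{j→∞}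 2^{−j} · #Q_{t,δ,j}. Let W be a nonempty open subset of ℝ^d and assume that for ℒ^d-almost every t ∈ W one has limsup_{δ→0⁺} Q̲_{t,δ} > 0. Let (R_n)_{n≥1} be a nonincreasing sequence of positive reals with Σ_n R_n = ∞. Then the set F = { t ∈ ℝ^d : |ρ_n − ⟨s_n, t⟩| < R_n for infinitely many n ≥ 1 } has full Lebesgue measure in W, i.e., ℒ^d(W \ F) = 0. -/
open MeasureTheory Filter Set
open scoped RealInnerProductSpace

/-- A half of the cell `{v | ⌊K * |v - u|⌋₊ = q}` containing a prescribed point of the cell. -/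
theorem exists_ordConnected_subset_cell {K : ℝ} (hK : 0 < K) (u y : ℝ) :
    ∃ J : Set ℝ, J.OrdConnected ∧ MeasurableSet J ∧ y ∈ J ∧ volume.real J = K⁻¹ ∧
      ∀ v ∈ J, ⌊K * |v - u|⌋₊ = ⌊K * |y - u|⌋₊ := by
  set q := ⌊K * |y - u|⌋₊ with hq
  have h1 : (q : ℝ) ≤ K * |y - u| := Nat.floor_le (by positivity)
  have h2 : K * |y - u| < q + 1 := Nat.lt_floor_add_one _
  rcases le_total u y with huy | huy
  · refine ⟨Ico (u + q / K) (u + (q + 1) / K), ordConnected_Ico, measurableSet_Ico, ?_, ?_, ?_⟩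
    · rw [abs_of_nonneg (by linarith)] at h1 h2
      constructor
      · have : q / K ≤ y - u := by rw [div_le_iff₀ hK]; linarith
        linarith
      · have : y - u < (q + 1) / K := by rw [lt_div_iff₀ hK]; linarith
        linarith
    · rw [Real.volume_real_Ico_of_le (by gcongr; linarith)]
      field_simp; ring
    · rintro v ⟨hv1, hv2⟩
      have h0 : 0 ≤ q / K := by positivity
      rw [abs_of_nonneg (by linarith), Nat.floor_eq_iff (mul_nonneg hK.le (by linarith))]
      constructor
      · have : q / K ≤ v - u := by linarith
        rw [div_le_iff₀ hK] at this; linarith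
      · have : v - u < (q + 1) / K := by linarith
        rw [lt_div_iff₀ hK] at this; linarith
  · refine ⟨Ioc (u - (q + 1) / K) (u - q / K), ordConnected_Ioc, measurableSet_Ioc, ?_, ?_, ?_⟩
    · rw [abs_of_nonpos (by linarith)] at h1 h2
      constructor
      · have : u - y < (q + 1) / K := by rw [lt_div_iff₀ hK]; linarith
        linarith
      · have : q / K ≤ u - y := by rw [div_le_iff₀ hK]; linarith
        linarith
    · rw [Real.volume_real_Ioc_of_le (by gcongr; linarith)]
      field_simp; ring
    · rintro v ⟨hv1, hv2⟩
      have h0 : 0 ≤ q / K := by positivity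
      rw [abs_of_nonpos (by linarith), Nat.floor_eq_iff (mul_nonneg hK.le (by linarith))]
      constructor
      · have : q / K ≤ u - v := by linarith
        rw [div_le_iff₀ hK] at this; linarith
      · have : u - v < (q + 1) / K := by linarith
        rw [lt_div_iff₀ hK] at this; linarith

/-- On a segment joining `b` to `y`, a `1`-Lipschitz function takes values between two levels
lying between its values at the end points on a set at least as long as the gap. -/
theorem LipschitzWith.sub_le_volume_real_uIcc_inter {f : ℝ → ℝ} (hf : LipschitzWith 1 f)
    {b y α β : ℝ} (hα : f b ≤ α) (hαβ : α ≤ β) (hβ : β ≤ f y) :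
    β - α ≤ volume.real (uIcc b y ∩ f ⁻¹' Ioo α β) := by
  have himg : Ioo α β ⊆ f '' (uIcc b y ∩ f ⁻¹' Ioo α β) := by
    intro z hz
    obtain ⟨v, hv, rfl⟩ := intermediate_value_uIcc (hf.continuous.continuousOn (s := uIcc b y))
      (Icc_subset_uIcc ⟨hα.trans hz.1.le, hz.2.le.trans hβ⟩)
    exact ⟨v, ⟨hv, hz⟩, rfl⟩
  have hlip := hf.hausdorffMeasure_image_le zero_le_one (uIcc b y ∩ f ⁻¹' Ioo α β)
  rw [hausdorffMeasure_real] at hlip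
  have hle : volume (Ioo α β) ≤ volume (uIcc b y ∩ f ⁻¹' Ioo α β) := by
    simpa using (measure_mono himg).trans hlip
  rw [← Real.volume_real_Ioo_of_le hαβ]
  exact ENNReal.toReal_mono
    ((measure_mono inter_subset_left).trans_lt isCompact_uIcc.measure_lt_top).ne hle

/-- The cells `{v | ⌊K * |v - u|⌋₊ = q}` with `q < K * δ` are disjoint parts of the ball of
radius `δ`. -/
theorem sum_volume_real_cell_inter_le {u δ : ℝ} (hδ : 0 < δ) {m : ℕ} (hm : 0 < m)
    {Q : Finset ℕ} (hQ : ∀ q ∈ Q, q < m) {S : Set ℝ} (hS : MeasurableSet S) :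
    ∑ q ∈ Q, volume.real ({v | ⌊m / δ * |v - u|⌋₊ = q} ∩ S) ≤
      volume.real (Metric.closedBall u δ ∩ S) := by
  have hm' : (0 : ℝ) < m := by exact_mod_cast hm
  have hsub : ∀ q ∈ Q, {v | ⌊m / δ * |v - u|⌋₊ = q} ∩ S ⊆ Metric.closedBall u δ ∩ S := by
    rintro q hq v ⟨hv, hvS⟩
    refine ⟨?_, hvS⟩
    have hv : ⌊m / δ * |v - u|⌋₊ = q := hv
    have h1 : m / δ * |v - u| < q + 1 := by rw [← hv]; exact Nat.lt_floor_add_one _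
    have h2 : (q : ℝ) + 1 ≤ m := by exact_mod_cast hQ q hq
    rw [Metric.mem_closedBall, Real.dist_eq]
    have h3 : m / δ * |v - u| ≤ m := by linarith
    rw [div_mul_eq_mul_div, div_le_iff₀ hδ] at h3
    exact le_of_mul_le_mul_left h3 hm'
  have hfin : volume (Metric.closedBall u δ ∩ S) ≠ ⊤ :=
    ((measure_mono inter_subset_left).trans_lt measure_closedBall_lt_top).ne
  rw [← measureReal_biUnion_finset (h := fun q hq =>
    ((measure_mono (hsub q hq)).trans_lt hfin.lt_top).ne)]
  · exact measureReal_mono (iUnion₂_subset hsub) hfin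
  · intro p _ q _ hpq
    refine Set.disjoint_left.2 ?_
    rintro v ⟨hp, _⟩ ⟨hq, _⟩
    exact hpq (Eq.trans (Eq.symm hp) hq)
  · intro q _
    refine MeasurableSet.inter ?_ hS
    have : Measurable fun v : ℝ => ⌊m / δ * |v - u|⌋₊ :=
      Nat.measurable_floor.comp (by fun_prop)
    exact this (measurableSet_singleton q)

/-- If many cells contain a point at distance at least `r` from `B`, and `B` nearly fills the ball,
then the set of points whose distance to `B` lies between two levels below `r` is large. -/
theorem card_mul_sub_le_volume_real {u δ : ℝ} (hδ : 0 < δ) {m : ℕ} (hm : 0 < m)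
    {B : Set ℝ} (hB : IsClosed B) {r α β : ℝ} (hα : 0 ≤ α) (hαβ : α ≤ β) (hβ : β ≤ r)
    {Q : Finset ℕ}
    (hQ : ∀ q ∈ Q, q < m ∧ ∃ y, r ≤ Metric.infDist y B ∧ q = ⌊m / δ * |y - u|⌋₊) :
    Q.card * (β - α) ≤
      volume.real (Metric.closedBall u δ ∩ (Metric.infDist · B) ⁻¹' Ioo α β) +
        (β - α) * (m / δ * volume.real (Metric.closedBall u δ \ B)) := by
  have hm' : (0 : ℝ) < m := by exact_mod_cast hm
  set D : ℝ → ℝ := (Metric.infDist · B) with hD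
  have hlip : LipschitzWith 1 D := Metric.lipschitz_infDist_pt B
  have hS1 : MeasurableSet (D ⁻¹' Ioo α β) := hlip.continuous.measurable measurableSet_Ioo
  have hcell : ∀ q ∈ Q, β - α ≤
      volume.real ({v | ⌊m / δ * |v - u|⌋₊ = q} ∩ D ⁻¹' Ioo α β) +
        (β - α) * (m / δ * volume.real ({v | ⌊m / δ * |v - u|⌋₊ = q} ∩ Bᶜ)) := by
    intro q hq
    obtain ⟨hqm, y, hy, rfl⟩ := hQ q hq
    have hfin : volume {v | ⌊m / δ * |v - u|⌋₊ = ⌊m / δ * |y - u|⌋₊} ≠ ⊤ := by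
      refine ((measure_mono (t := Metric.closedBall u (δ / m * (⌊m / δ * |y - u|⌋₊ + 1))) ?_).trans_lt
        measure_closedBall_lt_top).ne
      intro v hv
      have hv : ⌊m / δ * |v - u|⌋₊ = ⌊m / δ * |y - u|⌋₊ := hv
      rw [Metric.mem_closedBall, Real.dist_eq, ← hv]
      have := (Nat.lt_floor_add_one (m / δ * |v - u|)).le
      calc |v - u| = δ / m * (m / δ * |v - u|) := by field_simp
        _ ≤ _ := by gcongr
    obtain ⟨J, hJc, hJm, hyJ, hJv, hJ⟩ :=
      exists_ordConnected_subset_cell (K := m / δ) (by positivity) u y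
    by_cases hJB : ∃ b ∈ J, b ∈ B
    · obtain ⟨b, hbJ, hbB⟩ := hJB
      have h1 := hlip.sub_le_volume_real_uIcc_inter (b := b) (y := y) (α := α) (β := β)
        (by rw [hD]; simpa [Metric.infDist_zero_of_mem hbB] using hα) hαβ (hβ.trans hy)
      have h2 : volume.real (uIcc b y ∩ D ⁻¹' Ioo α β) ≤
          volume.real ({v | ⌊m / δ * |v - u|⌋₊ = ⌊m / δ * |y - u|⌋₊} ∩ D ⁻¹' Ioo α β) := by
        refine measureReal_mono
          (inter_subset_inter_left _ fun v hv => hJ v (hJc.uIcc_subset hbJ hyJ hv)) ?_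
        exact ((measure_mono inter_subset_left).trans_lt hfin.lt_top).ne
      have h3 : 0 ≤ (β - α) * (m / δ *
          volume.real ({v | ⌊m / δ * |v - u|⌋₊ = ⌊m / δ * |y - u|⌋₊} ∩ Bᶜ)) :=
        mul_nonneg (by linarith) (by positivity)
      linarith
    · have h1 : volume.real J ≤
          volume.real ({v | ⌊m / δ * |v - u|⌋₊ = ⌊m / δ * |y - u|⌋₊} ∩ Bᶜ) := by
        refine measureReal_mono (fun v hv => ⟨hJ v hv, fun hvB => hJB ⟨v, hv, hvB⟩⟩) ?_
        exact ((measure_mono inter_subset_left).trans_lt hfin.lt_top).ne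
      rw [hJv] at h1
      have h2 : 1 ≤ m / δ *
          volume.real ({v | ⌊m / δ * |v - u|⌋₊ = ⌊m / δ * |y - u|⌋₊} ∩ Bᶜ) := by
        calc (1 : ℝ) = m / δ * (m / δ)⁻¹ := by field_simp
          _ ≤ _ := by gcongr
      have h3 : 0 ≤ volume.real
          ({v | ⌊m / δ * |v - u|⌋₊ = ⌊m / δ * |y - u|⌋₊} ∩ D ⁻¹' Ioo α β) := measureReal_nonneg
      nlinarith
  calc Q.card * (β - α) = ∑ q ∈ Q, (β - α) := by rw [Finset.sum_const, nsmul_eq_mul]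
    _ ≤ _ := Finset.sum_le_sum hcell
    _ = ∑ q ∈ Q, volume.real ({v | ⌊m / δ * |v - u|⌋₊ = q} ∩ D ⁻¹' Ioo α β) +
        (β - α) * (m / δ * ∑ q ∈ Q, volume.real ({v | ⌊m / δ * |v - u|⌋₊ = q} ∩ Bᶜ)) := by
      rw [Finset.sum_add_distrib, Finset.mul_sum, Finset.mul_sum]
    _ ≤ _ := by
      have h0 : 0 ≤ β - α := by linarith
      rw [sdiff_eq]
      gcongr
      · exact sum_volume_real_cell_inter_le hδ hm (fun q hq => (hQ q hq).1) hS1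
      · exact sum_volume_real_cell_inter_le hδ hm (fun q hq => (hQ q hq).1)
          hB.measurableSet.compl

/-- Summation by parts for dyadic weights. -/
theorem mul_sum_two_pow_mul_le {a r : ℕ → ℝ} {c : ℝ} {k₀ : ℕ}
    (ha : ∀ k, k₀ ≤ k → c * 2 ^ k * r k ≤ a k)
    (hstep : ∀ k, k₀ ≤ k → a (k + 1) + c * 2 ^ k * (r k - r (k + 1)) ≤ a k) (n : ℕ) :
    ∀ k, k₀ ≤ k →
      c * (2 ^ k * r k + ∑ i ∈ Finset.range (n + 1), 2 ^ (k + i) * r (k + i)) ≤ 2 * a k := by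
  induction n with
  | zero =>
    intro k hk
    have := ha k hk
    rw [zero_add, Finset.sum_range_one, add_zero]
    linarith
  | succ n ih =>
    intro k hk
    have h1 := ih (k + 1) (by omega)
    have h2 := hstep k hk
    have h3 : ∑ i ∈ Finset.range (n + 1), (2 : ℝ) ^ (k + (i + 1)) * r (k + (i + 1)) =
        ∑ i ∈ Finset.range (n + 1), 2 ^ (k + 1 + i) * r (k + 1 + i) :=
      Finset.sum_congr rfl fun i _ => by rw [show k + (i + 1) = k + 1 + i by omega]
    rw [Finset.sum_range_succ', h3, add_zero]
    rw [pow_succ] at h1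
    linarith

/-- A form of Cauchy condensation along the indices `⌊2 ^ k / δ⌋₊`. -/
theorem summable_of_condensed_floor {R : ℕ → ℝ} (hRpos : ∀ n, 1 ≤ n → 0 < R n)
    (hRmono : ∀ m n : ℕ, 1 ≤ m → m ≤ n → R n ≤ R m) {δ : ℝ} (hδ : 0 < δ) {k : ℕ}
    (hk : δ ≤ 2 ^ k) {C : ℝ}
    (hC : ∀ n, ∑ i ∈ Finset.range n, 2 ^ (k + i) * R ⌊(2 : ℝ) ^ (k + i) / δ⌋₊ ≤ C) :
    Summable R := by
  set N : ℕ → ℕ := fun i => ⌊(2 : ℝ) ^ (k + i) / δ⌋₊ with hN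
  have hNmono : Monotone N := by
    intro i j hij
    refine Nat.floor_mono ?_
    gcongr
    norm_num
  have hNpos : ∀ i, 0 < N i := by
    intro i
    refine lt_of_lt_of_le ?_ (hNmono (Nat.zero_le i))
    rw [hN, Nat.floor_pos, le_div_iff₀ hδ]
    simpa using hk
  have hNlim : Tendsto N atTop atTop := by
    refine tendsto_nat_floor_atTop.comp (Tendsto.atTop_div_const hδ ?_)
    refine (tendsto_pow_atTop_atTop_of_one_lt (by norm_num : (1 : ℝ) < 2)).comp ?_
    exact tendsto_atTop_mono (fun i => Nat.le_add_left i k) tendsto_id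
  have hgap : ∀ i, ((N (i + 1) - N i : ℕ) : ℝ) ≤ (δ⁻¹ + 1) * 2 ^ (k + i) := by
    intro i
    rw [Nat.cast_sub (hNmono (Nat.le_succ i))]
    have h1 : (N (i + 1) : ℝ) ≤ 2 ^ (k + (i + 1)) / δ := Nat.floor_le (by positivity)
    have h2 : (2 : ℝ) ^ (k + i) / δ < N i + 1 := Nat.lt_floor_add_one _
    have h3 : (1 : ℝ) ≤ 2 ^ (k + i) := one_le_pow₀ (by norm_num)
    rw [← add_assoc, pow_succ] at h1
    rw [div_eq_mul_inv] at h1 h2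
    linarith
  rw [← summable_nat_add_iff (N 0)]
  refine summable_of_sum_range_le (c := (δ⁻¹ + 1) * C)
    (fun n => (hRpos _ (by have := hNpos 0; omega)).le) fun n => ?_
  obtain ⟨i, hi⟩ := (hNlim.eventually_ge_atTop (N 0 + n)).exists
  calc ∑ l ∈ Finset.range n, R (l + N 0) = ∑ l ∈ Finset.Ico (N 0) (N 0 + n), R l := by
        rw [Finset.sum_Ico_eq_sum_range]
        simp [add_comm]
    _ ≤ ∑ l ∈ Finset.Ico (N 0) (N i), R l := by
        refine Finset.sum_le_sum_of_subset_of_nonneg (Finset.Ico_subset_Ico_right hi) ?_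
        intro l hl _
        exact (hRpos l ((hNpos 0).trans_le (Finset.mem_Ico.1 hl).1)).le
    _ ≤ ∑ l ∈ Finset.range i, (N (l + 1) - N l) • R (N l) := by
        have := Finset.le_sum_schlomilch' (f := R) (u := N)
          (fun m n hm hmn => hRmono m n hm hmn) hNpos hNmono i
        exact this
    _ ≤ ∑ l ∈ Finset.range i, (δ⁻¹ + 1) * (2 ^ (k + l) * R (N l)) := by
        refine Finset.sum_le_sum fun l _ => ?_
        rw [nsmul_eq_mul, ← mul_assoc]
        exact mul_le_mul_of_nonneg_right (hgap l) (hRpos _ (hNpos l)).le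
    _ ≤ _ := by
        rw [← Finset.mul_sum]
        exact mul_le_mul_of_nonneg_left (hC i) (by positivity)

/-- If a closed set `B` keeps distance `R n` from each `X n`, nearly fills a ball, and the points
`X n` meet a positive proportion of the cells of that ball at every small scale, then `R` is
summable. -/
theorem summable_of_density_of_cells {X R : ℕ → ℝ} (hRpos : ∀ n, 1 ≤ n → 0 < R n)
    (hRmono : ∀ m n : ℕ, 1 ≤ m → m ≤ n → R n ≤ R m) {B : Set ℝ} (hBc : IsClosed B)
    (hBne : B.Nonempty) (hB : ∀ b ∈ B, ∀ n, 1 ≤ n → R n ≤ |X n - b|) {u δ c : ℝ} (hδ : 0 < δ)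
    (hc : 0 < c) (hvol : volume.real (Metric.closedBall u δ \ B) ≤ c / 2 * δ)
    (hcell : ∀ᶠ j : ℕ in atTop, c <
      (Set.ncard {q : ℕ | q < 2 ^ j ∧ ∃ n : ℕ, 1 ≤ n ∧ n ≤ ⌊(2 ^ j : ℝ) / δ⌋₊ ∧
        q = ⌊(2 ^ j : ℝ) / δ * |X n - u|⌋₊} : ℝ) / 2 ^ j) :
    Summable R := by
  obtain ⟨k₀, hk₀⟩ := eventually_atTop.1 (hcell.and
    ((tendsto_pow_atTop_atTop_of_one_lt (by norm_num : (1 : ℝ) < 2)).eventually_ge_atTop δ))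
  set r : ℕ → ℝ := fun k => R ⌊(2 : ℝ) ^ k / δ⌋₊ with hr
  have hN : ∀ k, k₀ ≤ k → 1 ≤ ⌊(2 : ℝ) ^ k / δ⌋₊ := by
    intro k hk
    rw [Nat.one_le_floor_iff, le_div_iff₀ hδ]
    simpa using (hk₀ k hk).2
  have hgap : ∀ k, k₀ ≤ k → ∀ α β, 0 ≤ α → α ≤ β → β ≤ r k → c / 2 * 2 ^ k * (β - α) ≤
      volume.real (Metric.closedBall u δ ∩ (Metric.infDist · B) ⁻¹' Ioo α β) := by
    intro k hk α β hα hαβ hβ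
    have hfin : {q : ℕ | q < 2 ^ k ∧ ∃ n : ℕ, 1 ≤ n ∧ n ≤ ⌊(2 ^ k : ℝ) / δ⌋₊ ∧
        q = ⌊(2 ^ k : ℝ) / δ * |X n - u|⌋₊}.Finite :=
      (finite_Iio (2 ^ k)).subset fun q hq => hq.1
    have hcard := (hk₀ k hk).1
    rw [ncard_eq_toFinset_card _ hfin, lt_div_iff₀ (by positivity)] at hcard
    have key := card_mul_sub_le_volume_real (u := u) hδ (m := 2 ^ k) (by positivity) hBc hα hαβ hβ
      (Q := hfin.toFinset) (by
        intro q hq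
        obtain ⟨hq, n, hn1, hn, rfl⟩ := hfin.mem_toFinset.1 hq
        refine ⟨hq, X n, ?_, by push_cast; rfl⟩
        refine (hRmono n _ hn1 hn).trans ((Metric.le_infDist hBne).2 fun b hb => ?_)
        exact hB b hb n hn1)
    push_cast at key
    have h1 : (2 : ℝ) ^ k / δ * volume.real (Metric.closedBall u δ \ B) ≤ c / 2 * 2 ^ k := by
      calc _ ≤ (2 : ℝ) ^ k / δ * (c / 2 * δ) := by gcongr
        _ = _ := by field_simp
    have h0 : 0 ≤ β - α := by linarith
    have h2 := mul_le_mul_of_nonneg_left h1 h0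
    have h3 := mul_le_mul_of_nonneg_right hcard.le h0
    linarith
  have hr0 : ∀ k, k₀ ≤ k → 0 ≤ r k := fun k hk => (hRpos _ (hN k hk)).le
  have hra : ∀ k, k₀ ≤ k → r (k + 1) ≤ r k := fun k hk =>
    hRmono _ _ (hN k hk) (Nat.floor_mono (by gcongr <;> norm_num))
  set a : ℕ → ℝ := fun k =>
    volume.real (Metric.closedBall u δ ∩ (Metric.infDist · B) ⁻¹' Ioo 0 (r k)) with ha
  have hfinite : ∀ S : Set ℝ, volume (Metric.closedBall u δ ∩ S) ≠ ⊤ := fun S =>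
    ((measure_mono inter_subset_left).trans_lt measure_closedBall_lt_top).ne
  have hsum := fun n => mul_sum_two_pow_mul_le (a := a) (r := r) (c := c / 2) (k₀ := k₀)
    (fun k hk => by simpa using hgap k hk 0 (r k) le_rfl (hr0 k hk) le_rfl)
    (fun k hk => by
      have h1 := hgap k hk (r (k + 1)) (r k) (hr0 _ (by omega)) (hra k hk) le_rfl
      refine (add_le_add_right h1 _).trans ?_
      rw [← measureReal_union _ _ (hfinite _) (hfinite _)]
      · refine measureReal_mono ?_ (hfinite _)
        rintro v (⟨hv, hv1, hv2⟩ | ⟨hv, hv1, hv2⟩)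
        · exact ⟨hv, hv1, hv2.trans_le (hra k hk)⟩
        · exact ⟨hv, (hr0 (k + 1) (by omega)).trans_lt hv1, hv2⟩
      · refine Set.disjoint_left.2 ?_
        rintro v ⟨_, _, hv⟩ ⟨_, hv', _⟩
        exact lt_asymm hv hv'
      · exact Metric.isClosed_closedBall.measurableSet.inter
          ((Metric.continuous_infDist_pt B).measurable measurableSet_Ioo)) n k₀ le_rfl
  refine summable_of_condensed_floor hRpos hRmono hδ (hk₀ k₀ le_rfl).2
    (C := 2 * a k₀ / (c / 2)) fun n => ?_
  rw [le_div_iff₀ (by positivity)]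
  have h1 := hsum n
  rw [Finset.sum_range_succ, mul_add, mul_add] at h1
  have h2 : 0 ≤ c / 2 * (2 ^ k₀ * r k₀) := by have := hr0 k₀ le_rfl; positivity
  have h3 : 0 ≤ c / 2 * (2 ^ (k₀ + n) * r (k₀ + n)) := by
    have := hr0 (k₀ + n) (by omega); positivity
  have h4 : ∑ i ∈ Finset.range n, (2 : ℝ) ^ (k₀ + i) * R ⌊(2 : ℝ) ^ (k₀ + i) / δ⌋₊ =
    ∑ i ∈ Finset.range n, (2 : ℝ) ^ (k₀ + i) * r (k₀ + i) := rfl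
  rw [h4]
  linarith

theorem isClosed_setOf_forall_le_abs_sub (X R : ℕ → ℝ) :
    IsClosed {u : ℝ | ∀ n, 1 ≤ n → R n ≤ |X n - u|} := by
  simp only [ofPred_forall]
  exact isClosed_iInter fun n => isClosed_iInter fun _ =>
    isClosed_le continuous_const (by fun_prop)

/-- Almost every point is a density point, so around almost every point of a measurable set
the complement of the set fills an arbitrarily small proportion of small balls. -/
theorem ae_eventually_volume_real_closedBall_sdiff_le {B : Set ℝ} (hB : MeasurableSet B) :
    ∀ᵐ u, u ∈ B → ∀ ε > 0, ∀ᶠ δ in nhdsWithin (0 : ℝ) (Ioi 0),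
      volume.real (Metric.closedBall u δ \ B) ≤ ε * δ := by
  have h := Besicovitch.ae_tendsto_measure_inter_div (volume : Measure ℝ) B
  rw [ae_restrict_iff' hB] at h
  filter_upwards [h] with u hu huB ε hε
  have h1 := (ENNReal.tendsto_toReal ENNReal.one_ne_top).comp (hu huB)
  have h2 := h1.eventually_const_lt (u := 1 - ε / 2) (by simpa using hε)
  filter_upwards [h2, self_mem_nhdsWithin] with δ hδ hδ0
  have hδ0 : 0 < δ := hδ0
  have hfin : volume (Metric.closedBall u δ) ≠ ⊤ := measure_closedBall_lt_top.ne
  have hball : volume.real (Metric.closedBall u δ) = 2 * δ := by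
    rw [measureReal_def, Real.volume_closedBall, ENNReal.toReal_ofReal (by linarith)]
  have hadd := measureReal_inter_add_sdiff (μ := volume) (s := Metric.closedBall u δ) hB hfin
  simp only [Function.comp_apply, ENNReal.toReal_div] at hδ
  rw [← measureReal_def, ← measureReal_def, hball, lt_div_iff₀ (by linarith), inter_comm] at hδ
  linarith

/-- The one-dimensional case, for a sequence of points `X n` of the line. -/
theorem ae_frequently_abs_sub_lt {X R : ℕ → ℝ} (hRpos : ∀ n, 1 ≤ n → 0 < R n)
    (hRmono : ∀ m n : ℕ, 1 ≤ m → m ≤ n → R n ≤ R m) (hRdiv : ¬ Summable R) :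
    ∀ᵐ u : ℝ, 0 < limsup
        (fun δ : ℝ => liminf
          (fun j : ℕ =>
            (Set.ncard {q : ℕ | q < 2 ^ j ∧ ∃ n : ℕ, 1 ≤ n ∧ n ≤ ⌊(2 ^ j : ℝ) / δ⌋₊ ∧
              q = ⌊(2 ^ j : ℝ) / δ * |X n - u|⌋₊} : ℝ) / 2 ^ j)
          atTop)
        (nhdsWithin 0 (Set.Ioi (0 : ℝ))) →
      ∃ᶠ n in atTop, |X n - u| < R n := by
  have hdens : ∀ᵐ u : ℝ, ∀ k : ℕ, u ∈ {u : ℝ | ∀ n, 1 ≤ n → R n / (k + 1) ≤ |X n - u|} →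
      ∀ ε > 0, ∀ᶠ δ in nhdsWithin (0 : ℝ) (Ioi 0), volume.real (Metric.closedBall u δ \
        {u : ℝ | ∀ n, 1 ≤ n → R n / (k + 1) ≤ |X n - u|}) ≤ ε * δ :=
    ae_all_iff.2 fun k => ae_eventually_volume_real_closedBall_sdiff_le
      (isClosed_setOf_forall_le_abs_sub X fun n => R n / (k + 1)).measurableSet
  filter_upwards [hdens, (countable_range X).ae_notMem volume] with u hu huX hlim
  by_contra hfreq
  rw [not_frequently] at hfreq
  obtain ⟨n₀, hn₀⟩ := eventually_atTop.1 hfreq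
  have hpos : ∀ n, 0 < |X n - u| := fun n =>
    abs_pos.2 (sub_ne_zero.2 fun h => huX ⟨n, h⟩)
  obtain ⟨k, hk⟩ : ∃ k : ℕ, ∀ n, 1 ≤ n → R n / (k + 1) ≤ |X n - u| := by
    obtain ⟨k, hk⟩ := exists_nat_ge (∑ n ∈ Finset.range n₀, |R n| / |X n - u|)
    refine ⟨k, fun n hn => ?_⟩
    rcases lt_or_ge n n₀ with h | h
    · have h1 : |R n| / |X n - u| ≤ ∑ n ∈ Finset.range n₀, |R n| / |X n - u| :=
        Finset.single_le_sum (f := fun n => |R n| / |X n - u|) (fun i _ => by positivity)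
          (Finset.mem_range.2 h)
      have h2 : |R n| / |X n - u| ≤ k + 1 := by linarith
      rw [div_le_iff₀ (hpos n)] at h2
      rw [div_le_iff₀ (by positivity), mul_comm]
      exact (le_abs_self _).trans h2
    · refine (div_le_self (hRpos n hn).le ?_).trans (not_lt.1 (hn₀ n h))
      linarith [(Nat.cast_nonneg k : (0 : ℝ) ≤ k)]
  have hk1 : (0 : ℝ) < k + 1 := by positivity
  have hle1 : ∀ (δ : ℝ) (j : ℕ),
      (Set.ncard {q : ℕ | q < 2 ^ j ∧ ∃ n : ℕ, 1 ≤ n ∧ n ≤ ⌊(2 ^ j : ℝ) / δ⌋₊ ∧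
        q = ⌊(2 ^ j : ℝ) / δ * |X n - u|⌋₊} : ℝ) / 2 ^ j ≤ 1 := by
    intro δ j
    rw [div_le_one (by positivity)]
    have h := ncard_le_ncard (s := {q : ℕ | q < 2 ^ j ∧ ∃ n : ℕ, 1 ≤ n ∧ n ≤ ⌊(2 ^ j : ℝ) / δ⌋₊ ∧
        q = ⌊(2 ^ j : ℝ) / δ * |X n - u|⌋₊}) (t := Iio (2 ^ j)) (fun q hq => hq.1) (finite_Iio _)
    have h' : (Iio (2 ^ j : ℕ)).ncard = 2 ^ j := by
      rw [← Finset.coe_Iio, ncard_coe_finset, Nat.card_Iio]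
    rw [h'] at h
    exact_mod_cast h
  obtain ⟨c, hc0, hc⟩ := exists_between hlim
  have hfr := frequently_lt_of_lt_limsup (isCoboundedUnder_le_of_le _ (x := 0) fun δ =>
    le_liminf_of_le (isCoboundedUnder_ge_of_le _ (hle1 δ))
      (Eventually.of_forall fun j => by positivity)) hc
  obtain ⟨δ, hδc, hδv, hδ0⟩ :=
    (hfr.and_eventually ((hu k hk (c / 2) (by linarith)).and self_mem_nhdsWithin)).exists
  have hev := eventually_lt_of_lt_liminf hδc
    (isBoundedUnder_of ⟨0, fun j => by positivity⟩)
  have hsum := summable_of_density_of_cells (X := X) (R := fun n => R n / (k + 1))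
    (fun n hn => div_pos (hRpos n hn) hk1)
    (fun m n hm hmn => div_le_div_of_nonneg_right (hRmono m n hm hmn) hk1.le)
    (isClosed_setOf_forall_le_abs_sub X fun n => R n / (k + 1)) ⟨u, hk⟩ (fun b hb => hb)
    hδ0 hc0 hδv hev
  refine hRdiv ((hsum.mul_right ((k : ℝ) + 1)).congr fun n => ?_)
  field_simp

/-- Ubiquity for homogeneously distributed hyperplanes: if the hyperplanes
`H_n = {t : ρ n = ⟪s n, t⟫}` are homogeneously distributed in the open set `W` in the
direction `𝔰`, and `(R n)` is a nonincreasing sequence of positive reals with divergent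
sum, then the set of points within distance `R n` of `H_n` for infinitely many `n`
has full Lebesgue measure in `W`. -/
theorem stmt4 (d : ℕ) (hd : 1 ≤ d)
    (𝔰 : EuclideanSpace ℝ (Fin d)) (h𝔰 : ‖𝔰‖ = 1)
    (ρ : ℕ → ℝ) (s : ℕ → EuclideanSpace ℝ (Fin d))
    (hρ : ∀ n : ℕ, 1 ≤ n → 0 < ρ n) (hs : ∀ n : ℕ, 1 ≤ n → ‖s n‖ = 1)
    (hperp : ∀ n : ℕ, 1 ≤ n → ⟪s n, 𝔰⟫ ≠ 0)
    (ξ : EuclideanSpace ℝ (Fin d) → ℕ → ℝ)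
    (hξ : ∀ t n, ξ t n = (ρ n - ⟪s n, t⟫) / ⟪s n, 𝔰⟫)
    (W : Set (EuclideanSpace ℝ (Fin d))) (hW : IsOpen W) (hWne : W.Nonempty)
    (hhom : ∀ᵐ t ∂(volume.restrict W),
      0 < limsup
        (fun δ : ℝ => liminf
          (fun j : ℕ =>
            (Set.ncard {q : ℕ | q < 2 ^ j ∧ ∃ n : ℕ, 1 ≤ n ∧ n ≤ ⌊(2 ^ j : ℝ) / δ⌋₊ ∧
              q = ⌊(2 ^ j : ℝ) / δ * |ξ t n|⌋₊} : ℝ) / 2 ^ j)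
          atTop)
        (nhdsWithin 0 (Set.Ioi (0 : ℝ))))
    (R : ℕ → ℝ) (hRpos : ∀ n : ℕ, 1 ≤ n → 0 < R n)
    (hRmono : ∀ m n : ℕ, 1 ≤ m → m ≤ n → R n ≤ R m)
    (hRdiv : ¬ Summable R) :
    volume (W \ {t : EuclideanSpace ℝ (Fin d) |
      ∃ᶠ n in atTop, |ρ n - ⟪s n, t⟫| < R n}) = 0 := by
  set F : Set (EuclideanSpace ℝ (Fin d)) :=
    {t | ∃ᶠ n in atTop, |ρ n - ⟪s n, t⟫| < R n} with hF
  have hFm : MeasurableSet F := by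
    have : F = ⋂ N : ℕ, ⋃ n : ℕ, ⋃ _ : N ≤ n, {t | |ρ n - ⟪s n, t⟫| < R n} := by
      ext t
      simp [hF, frequently_atTop]
    rw [this]
    refine MeasurableSet.iInter fun N => MeasurableSet.iUnion fun n => MeasurableSet.iUnion
      fun _ => (isOpen_lt (by fun_prop) continuous_const).measurableSet
  rw [ae_restrict_iff' hW.measurableSet] at hhom
  obtain ⟨N, hNsub, hNm, hNnull⟩ := exists_measurable_superset_of_null (ae_iff.1 hhom)
  have hNae : ∀ᵐ t : EuclideanSpace ℝ (Fin d), t ∈ Nᶜ := compl_mem_ae_iff.2 hNnull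
  let L : ℝ →ₗ[ℝ] EuclideanSpace ℝ (Fin d) := LinearMap.toSpanSingleton ℝ _ 𝔰
  have hline := (ae_ae_add_linearMap_mem_iff L volume volume hNm.compl).2 hNae
  have hgoal : ∀ᵐ t : EuclideanSpace ℝ (Fin d), t ∈ Wᶜ ∪ F := by
    rw [← ae_ae_add_linearMap_mem_iff L volume volume (hW.measurableSet.compl.union hFm)]
    filter_upwards [hline] with y hy
    filter_upwards [hy, ae_frequently_abs_sub_lt (X := ξ y) hRpos hRmono hRdiv] with x hx hfr
    by_cases hxW : y + L x ∈ W
    · right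
      have hξL : ∀ n, 1 ≤ n → ξ (y + L x) n = ξ y n - x := by
        intro n hn
        have := hperp n hn
        simp only [hξ, L, LinearMap.toSpanSingleton_apply, inner_add_right, inner_smul_right]
        field_simp
        ring
      have hpos := not_not.1 (fun h => hx (hNsub h)) hxW
      have hset : ∀ (δ : ℝ) (j : ℕ), {q : ℕ | q < 2 ^ j ∧ ∃ n : ℕ, 1 ≤ n ∧
          n ≤ ⌊(2 ^ j : ℝ) / δ⌋₊ ∧ q = ⌊(2 ^ j : ℝ) / δ * |ξ (y + L x) n|⌋₊} =
          {q : ℕ | q < 2 ^ j ∧ ∃ n : ℕ, 1 ≤ n ∧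
          n ≤ ⌊(2 ^ j : ℝ) / δ⌋₊ ∧ q = ⌊(2 ^ j : ℝ) / δ * |ξ y n - x|⌋₊} := by
        intro δ j
        ext q
        refine and_congr_right fun _ => exists_congr fun n => and_congr_right fun hn => ?_
        rw [hξL n hn]
      simp only [hset] at hpos
      refine ((hfr hpos).and_eventually (eventually_ge_atTop 1)).mono ?_
      rintro n ⟨hn, hn1⟩
      refine lt_of_le_of_lt ?_ hn
      rw [← hξL n hn1, hξ, abs_div, le_div_iff₀ (abs_pos.2 (hperp n hn1))]
      refine mul_le_of_le_one_right (abs_nonneg _) ?_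
      simpa [hs n hn1, h𝔰] using abs_real_inner_le_norm (s n) 𝔰
    · exact Or.inl hxW
  have hcompl : W \ F = (Wᶜ ∪ F)ᶜ := by
    rw [compl_union, compl_compl, sdiff_eq]
  rw [hcompl]
  exact hgoal
end

section
/- Let (x_n)_{n≥1} be a sequence of real numbers and let (r_n)_{n≥1} be a nonincreasing sequence of positive reals with Σ_n r_n = ∞. Let δ ∈ (0,1). For an integer j ≥ 0, define Q_{δ,j} = { q ∈ {0,…,2^j−1} : q = ⌊(2^j/δ)|x_n|⌋ for some integer n with 1 ≤ n ≤ ⌊2^j/δ⌋ }, and Q̲_δ = liminf_{j→∞} 2^{−j} · #Q_{δ,j}. Let E = { τ ∈ ℝ : |τ − x_n| < r_n for infinitely many n ≥ 1 }. Then the one-dimensional Lebesgue measure satisfies ℒ¹( E ∩ (−δ, δ) ) ≥ (δ/18) · Q̲_δ². -/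
open MeasureTheory Filter Set

/-- The **Chung–Erdős inequality** for a finite family of events in a finite measure. -/
lemma sq_sum_measureReal_le {Ω ι : Type*} [MeasurableSpace Ω] (μ : Measure Ω)
    (s : Finset ι) (A : ι → Set Ω) (hA : ∀ i ∈ s, MeasurableSet (A i))
    (hfin : ∀ i ∈ s, μ (A i) ≠ ⊤) :
    (∑ i ∈ s, μ.real (A i)) ^ 2 ≤
      μ.real (⋃ i ∈ s, A i) * ∑ i ∈ s, ∑ j ∈ s, μ.real (A i ∩ A j) := by
  set U := ⋃ i ∈ s, A i
  have hU : MeasurableSet U := s.measurableSet_biUnion hA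
  have hUfin : μ U ≠ ⊤ := (measure_biUnion_lt_top s.finite_toSet
    fun i hi => (hfin i hi).lt_top).ne
  have hint : ∀ i ∈ s, Integrable ((A i).indicator fun _ => (1 : ℝ)) μ := fun i hi =>
    (integrable_indicator_iff (hA i hi)).2 (integrableOn_const (hfin i hi))
  have hint₂ : ∀ i ∈ s, ∀ j ∈ s, Integrable ((A i ∩ A j).indicator fun _ => (1 : ℝ)) μ :=
    fun i hi j hj => (integrable_indicator_iff ((hA i hi).inter (hA j hj))).2
      (integrableOn_const (measure_ne_top_of_subset inter_subset_left (hfin i hi)))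
  have hintU : Integrable (U.indicator fun _ => (1 : ℝ)) μ :=
    (integrable_indicator_iff hU).2 (integrableOn_const hUfin)
  have key : ∀ t : ℝ, 0 ≤ μ.real U * (t * t) + (-2 * ∑ i ∈ s, μ.real (A i)) * t +
      ∑ i ∈ s, ∑ j ∈ s, μ.real (A i ∩ A j) := by
    intro t
    have hpt : ∀ ω, 2 * t * ∑ i ∈ s, (A i).indicator (fun _ => (1 : ℝ)) ω ≤
        (∑ i ∈ s, ∑ j ∈ s, (A i ∩ A j).indicator (fun _ => (1 : ℝ)) ω) +
          t ^ 2 * U.indicator (fun _ => (1 : ℝ)) ω := by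
      intro ω
      have hsq : ∑ i ∈ s, ∑ j ∈ s, (A i ∩ A j).indicator (fun _ => (1 : ℝ)) ω =
          (∑ i ∈ s, (A i).indicator (fun _ => (1 : ℝ)) ω) ^ 2 := by
        rw [sq, Finset.sum_mul_sum]
        refine Finset.sum_congr rfl fun i _ => Finset.sum_congr rfl fun j _ => ?_
        by_cases hi : ω ∈ A i <;> by_cases hj : ω ∈ A j <;> simp [hi, hj]
      rw [hsq]
      by_cases hω : ω ∈ U
      · rw [indicator_of_mem hω]
        nlinarith [sq_nonneg (∑ i ∈ s, (A i).indicator (fun _ => (1 : ℝ)) ω - t)]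
      · have h0 : ∑ i ∈ s, (A i).indicator (fun _ => (1 : ℝ)) ω = 0 :=
          Finset.sum_eq_zero fun i hi =>
            indicator_of_notMem (fun h => hω (mem_biUnion hi h)) _
        simp [h0, hω]
    have hmono := integral_mono (μ := μ) ((integrable_finsetSum s hint).const_mul (2 * t))
      ((integrable_finsetSum s fun i hi => integrable_finsetSum s (hint₂ i hi)).add
        (hintU.const_mul (t ^ 2))) hpt
    have hrhs : ∫ ω, ((∑ i ∈ s, ∑ j ∈ s, (A i ∩ A j).indicator (fun _ => (1 : ℝ)) ω) +
          t ^ 2 * U.indicator (fun _ => (1 : ℝ)) ω) ∂μ =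
        (∑ i ∈ s, ∑ j ∈ s, μ.real (A i ∩ A j)) + t ^ 2 * μ.real U := by
      rw [integral_add (integrable_finsetSum s fun i hi => integrable_finsetSum s (hint₂ i hi))
        (hintU.const_mul (t ^ 2)), integral_finsetSum s fun i hi =>
        integrable_finsetSum s (hint₂ i hi), integral_const_mul]
      congr 1
      · refine Finset.sum_congr rfl fun i hi => ?_
        rw [integral_finsetSum s (hint₂ i hi)]
        refine Finset.sum_congr rfl fun j hj => ?_
        exact integral_indicator_one ((hA i hi).inter (hA j hj))
      · rw [← integral_indicator_one hU]; rfl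
    have hlhs : ∫ ω, 2 * t * ∑ i ∈ s, (A i).indicator (fun _ => (1 : ℝ)) ω ∂μ =
        2 * t * ∑ i ∈ s, μ.real (A i) := by
      rw [integral_const_mul, integral_finsetSum s hint]
      congr 1
      exact Finset.sum_congr rfl fun i hi => integral_indicator_one (hA i hi)
    have hfinal := hlhs.symm.le.trans (hmono.trans hrhs.le)
    linarith
  have hdisc := discrim_le_zero key
  rw [discrim] at hdisc
  linarith

/-- If the numbers `K * |x n|`, `n ∈ G`, have distinct integer parts, then at most `2KR + 2` of
the points `x n` lie at distance less than `R` from `y`. -/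
lemma card_filter_abs_sub_lt_le (x : ℕ → ℝ) {K R y : ℝ} (hK : 0 < K) (hR : 0 ≤ R) (G : Finset ℕ)
    (hG : InjOn (fun n => ⌊K * |x n|⌋₊) (G : Set ℕ)) :
    ((G.filter fun n => |x n - y| < R).card : ℝ) ≤ 2 * K * R + 2 := by
  have hcard : (G.filter fun n => |x n - y| < R).card ≤
      (Finset.Icc ⌊K * (|y| - R)⌋ ⌊K * (|y| + R)⌋).card := by
    refine Finset.card_le_card_of_injOn (fun n => (⌊K * |x n|⌋₊ : ℤ)) ?_ ?_
    · intro n hn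
      have hn' : |x n - y| < R := (Finset.mem_filter.1 hn).2
      have h₁ := abs_lt.1 ((abs_abs_sub_abs_le (x n) y).trans_lt hn')
      have hnn : (0 : ℝ) ≤ K * |x n| := by positivity
      simp only [Finset.coe_Icc, mem_Icc, Int.natCast_floor_eq_floor hnn]
      constructor <;> apply Int.floor_le_floor <;> apply mul_le_mul_of_nonneg_left _ hK.le <;>
        linarith
    · intro m hm n hn hmn
      exact hG (Finset.mem_filter.1 hm).1 (Finset.mem_filter.1 hn).1 (Int.ofNat.inj hmn)
  have hle : ⌊K * (|y| - R)⌋ ≤ ⌊K * (|y| + R)⌋ :=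
    Int.floor_le_floor (mul_le_mul_of_nonneg_left (by linarith) hK.le)
  have hcard' : ((Finset.Icc ⌊K * (|y| - R)⌋ ⌊K * (|y| + R)⌋).card : ℝ) =
      ⌊K * (|y| + R)⌋ + 1 - ⌊K * (|y| - R)⌋ := by
    rw [Int.card_Icc]
    have : (((⌊K * (|y| + R)⌋ + 1 - ⌊K * (|y| - R)⌋).toNat : ℤ) : ℝ) =
        ((⌊K * (|y| + R)⌋ + 1 - ⌊K * (|y| - R)⌋ : ℤ) : ℝ) := by
      rw [Int.toNat_of_nonneg (by omega)]
    push_cast at this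
    exact this
  have h₁ := Int.floor_le (K * (|y| + R))
  have h₂ := Int.lt_floor_add_one (K * (|y| - R))
  have h₃ : ((G.filter fun n => |x n - y| < R).card : ℝ) ≤
      (Finset.Icc ⌊K * (|y| - R)⌋ ⌊K * (|y| + R)⌋).card := by exact_mod_cast hcard
  rw [hcard'] at h₃
  nlinarith

/-- One representative index for each occupied cell, leaving out the outermost cell. -/
lemma exists_representatives (x : ℕ → ℝ) (K : ℝ) (M N : ℕ) :
    ∃ F : Finset ℕ, (∀ n ∈ F, 1 ≤ n ∧ n ≤ N ∧ ⌊K * |x n|⌋₊ + 1 < M) ∧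
      InjOn (fun n => ⌊K * |x n|⌋₊) (F : Set ℕ) ∧
      Set.ncard {q : ℕ | q < M ∧ ∃ n : ℕ, 1 ≤ n ∧ n ≤ N ∧ q = ⌊K * |x n|⌋₊} ≤ F.card + 1 := by
  classical
  set s := (Finset.Icc 1 N).filter fun n => ⌊K * |x n|⌋₊ + 1 < M with hs
  obtain ⟨F, hFs, hinj, himg⟩ := Finset.exists_subset_injOn_image_eq_of_surjOn
    (f := fun n => ⌊K * |x n|⌋₊) (s : Set ℕ) (s.image fun n => ⌊K * |x n|⌋₊)
    (by simpa using surjOn_image _ _)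
  refine ⟨F, fun n hn => ?_, hinj, ?_⟩
  · have := hFs hn
    simpa [hs, and_assoc] using this
  · rw [← Finset.card_image_of_injOn hinj, himg]
    refine le_trans ?_ (Finset.card_insert_le (M - 1) _)
    rw [← Set.ncard_coe_finset]
    refine Set.ncard_le_ncard ?_ (Finset.finite_toSet _)
    rintro q ⟨hq, n, hn₁, hnN, rfl⟩
    rcases Nat.lt_or_ge (⌊K * |x n|⌋₊ + 1) M with h | h
    · refine Finset.mem_coe.2 (Finset.mem_insert_of_mem (Finset.mem_image_of_mem _ ?_))
      simp [hs, hn₁, hnN, h]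
    · refine Finset.mem_coe.2 (Finset.mem_insert.2 (Or.inl ?_))
      omega

/-- A non-summable nonnegative sequence stays non-summable when truncated at a positive level. -/
lemma not_summable_min_const {a : ℕ → ℝ} {c : ℝ} (hc : 0 < c) (ha : ¬ Summable a) :
    ¬ Summable fun j => min (a j) c := by
  intro h
  refine ha ((summable_congr_atTop ?_).1 h)
  filter_upwards [h.tendsto_atTop_zero.eventually (gt_mem_nhds hc)] with j hj
  rcases min_lt_iff.1 hj with h | h
  · exact min_eq_left h.le
  · exact absurd h (lt_irrefl _)

/-- Dyadic radii dominated by `r` at scale `2 ^ j / δ`, at most the mesh size, and still with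
divergent weighted sum. -/
lemma exists_dyadic_radii (r : ℕ → ℝ) (hrpos : ∀ n : ℕ, 1 ≤ n → 0 < r n)
    (hrmono : ∀ m n : ℕ, 1 ≤ m → m ≤ n → r n ≤ r m) (hrdiv : ¬ Summable r)
    {δ : ℝ} (hδ : 0 < δ) :
    ∃ ρ : ℕ → ℝ, (∀ j, 0 < ρ j) ∧ (∀ j, ρ j ≤ δ / 2 ^ j) ∧
      (∀ j n, 1 ≤ n → n ≤ ⌊(2 ^ j : ℝ) / δ⌋₊ → ρ j ≤ r n) ∧
      ¬ Summable fun j => 2 ^ j * ρ j := by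
  obtain ⟨p, hp⟩ := pow_unbounded_of_one_lt (1 / δ) (one_lt_two : (1 : ℝ) < 2)
  refine ⟨fun j => min (r (2 ^ (j + p))) (δ / 2 ^ j),
    fun j => lt_min (hrpos _ Nat.one_le_two_pow) (by positivity), fun j => min_le_right _ _,
    fun j n hn hnN => (min_le_left _ _).trans (hrmono n _ hn ?_), ?_⟩
  · refine hnN.trans (Nat.floor_le_of_le ?_)
    push_cast
    rw [pow_add, div_eq_mul_one_div]
    exact mul_le_mul_of_nonneg_left hp.le (by positivity)
  · have hcond : ¬ Summable fun k : ℕ => (2 : ℝ) ^ k * |r (2 ^ k)| := by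
      rw [summable_condensed_iff_of_nonneg (f := fun n => |r n|) (fun n => abs_nonneg _),
        summable_abs_iff]
      · exact hrdiv
      · intro m n hm hmn
        rw [abs_of_pos (hrpos m hm), abs_of_pos (hrpos n (hm.trans_le hmn))]
        exact hrmono m n hm hmn
    have hshift : ¬ Summable fun j : ℕ => (2 : ℝ) ^ j * r (2 ^ (j + p)) := by
      rw [← summable_nat_add_iff p] at hcond
      refine fun h => hcond ((h.mul_left ((2 : ℝ) ^ p)).congr fun j => ?_)
      rw [abs_of_pos (hrpos _ Nat.one_le_two_pow), pow_add]
      ring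
    convert not_summable_min_const hδ hshift using 3 with j
    rw [mul_min_of_nonneg _ _ (by positivity), mul_div_cancel₀ _ (by positivity)]

/-- Overlap of two families of intervals, the second one centred at well spread points. -/
lemma sum_measureReal_ball_inter_le (x : ℕ → ℝ) {K ρ σ : ℝ} (hK : 0 < K) (hρ : 0 ≤ ρ)
    (hσ : 0 ≤ σ) (F G : Finset ℕ) (hG : InjOn (fun n => ⌊K * |x n|⌋₊) (G : Set ℕ)) :
    ∑ m ∈ F, ∑ n ∈ G, volume.real (Metric.ball (x m) ρ ∩ Metric.ball (x n) σ) ≤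
      F.card * ((2 * K * (ρ + σ) + 2) * (2 * σ)) := by
  rw [← nsmul_eq_mul]
  refine Finset.sum_le_card_nsmul _ _ _ fun m _ => ?_
  have hterm : ∀ n ∈ G, volume.real (Metric.ball (x m) ρ ∩ Metric.ball (x n) σ) ≤
      if |x n - x m| < ρ + σ then 2 * σ else 0 := by
    intro n _
    split_ifs with h
    · refine (measureReal_mono inter_subset_right measure_ball_lt_top.ne).trans ?_
      rw [Real.volume_real_ball hσ]
    · have : Metric.ball (x m) ρ ∩ Metric.ball (x n) σ = ∅ := by
        refine (Metric.ball_disjoint_ball ?_).inter_eq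
        rw [dist_comm, Real.dist_eq]
        exact not_lt.1 h
      simp [this]
  refine (Finset.sum_le_sum hterm).trans ?_
  rw [← Finset.sum_filter, Finset.sum_const, nsmul_eq_mul]
  exact mul_le_mul_of_nonneg_right
    (card_filter_abs_sub_lt_le x hK (add_nonneg hρ hσ) G hG) (by positivity)

lemma sum_sum_ite_two_pow_le (a b : ℕ) (ρ : ℕ → ℝ) (hρ : ∀ j, 0 ≤ ρ j) :
    ∑ i ∈ Finset.Ico a b, ∑ j ∈ Finset.Ico a b, (if i ≤ j then 2 ^ i * ρ j else 0) ≤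
      2 * ∑ j ∈ Finset.Ico a b, 2 ^ j * ρ j := by
  rw [Finset.sum_comm, Finset.mul_sum]
  refine Finset.sum_le_sum fun j _ => ?_
  rw [← Finset.sum_filter, ← Finset.sum_mul, ← mul_assoc]
  refine mul_le_mul_of_nonneg_right ?_ (hρ j)
  have h : ∑ i ∈ (Finset.Ico a b).filter (· ≤ j), 2 ^ i < 2 ^ (j + 1) :=
    Nat.geomSum_lt le_rfl fun k hk => Nat.lt_succ_of_le (Finset.mem_filter.1 hk).2
  rw [← pow_succ']
  exact_mod_cast h.le

/-- Second moment bound for a dyadic block of well spread intervals. -/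
lemma sum_sum_measureReal_ball_inter_le (x : ℕ → ℝ) {δ : ℝ} (hδ : 0 < δ) (F : ℕ → Finset ℕ)
    (hF : ∀ j, InjOn (fun n => ⌊(2 ^ j : ℝ) / δ * |x n|⌋₊) (F j : Set ℕ))
    (hcard : ∀ j, (F j).card ≤ 2 ^ j) (ρ : ℕ → ℝ) (hρ : ∀ j, 0 < ρ j)
    (hρδ : ∀ j, ρ j ≤ δ / 2 ^ j) (a b : ℕ) :
    ∑ i ∈ Finset.Ico a b, ∑ j ∈ Finset.Ico a b, ∑ m ∈ F i, ∑ n ∈ F j,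
        volume.real (Metric.ball (x m) (ρ i) ∩ Metric.ball (x n) (ρ j)) ≤
      4 / δ * (∑ j ∈ Finset.Ico a b, 2 ^ j * ρ j) ^ 2 +
        32 * ∑ j ∈ Finset.Ico a b, 2 ^ j * ρ j := by
  have hone : ∀ i j, ∑ m ∈ F i, ∑ n ∈ F j,
      volume.real (Metric.ball (x m) (ρ i) ∩ Metric.ball (x n) (ρ j)) ≤
        4 / δ * ((2 ^ i * ρ i) * (2 ^ j * ρ j)) + 8 * (2 ^ i * ρ j) := by
    intro i j
    have hρj := hρ j
    have hρi := hρ i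
    refine (sum_measureReal_ball_inter_le x (by positivity) hρi.le hρj.le (F i) (F j)
      (hF j)).trans ?_
    have hc : ((F i).card : ℝ) ≤ 2 ^ i := by exact_mod_cast hcard i
    have hKρ : (2 : ℝ) ^ j / δ * ρ j ≤ 1 := by
      calc (2 : ℝ) ^ j / δ * ρ j ≤ 2 ^ j / δ * (δ / 2 ^ j) :=
            mul_le_mul_of_nonneg_left (hρδ j) (by positivity)
        _ = 1 := by field_simp
    calc ((F i).card : ℝ) * ((2 * (2 ^ j / δ) * (ρ i + ρ j) + 2) * (2 * ρ j))
        ≤ 2 ^ i * ((2 * (2 ^ j / δ) * ρ i + 4) * (2 * ρ j)) := by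
          refine mul_le_mul hc (mul_le_mul_of_nonneg_right ?_ (by positivity))
            (by positivity) (by positivity)
          linarith
      _ = _ := by ring
  have hpair : ∀ i j, ∑ m ∈ F i, ∑ n ∈ F j,
      volume.real (Metric.ball (x m) (ρ i) ∩ Metric.ball (x n) (ρ j)) ≤
        4 / δ * ((2 ^ i * ρ i) * (2 ^ j * ρ j)) +
          8 * (if i ≤ j then 2 ^ i * ρ j else 0) + 8 * (if j ≤ i then 2 ^ j * ρ i else 0) := by
    intro i j
    have hρj := hρ j
    have hρi := hρ i
    rcases le_total i j with h | h
    · rw [if_pos h]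
      refine (hone i j).trans (le_add_of_nonneg_right ?_)
      split_ifs <;> positivity
    · rw [if_pos h, Finset.sum_comm]
      simp_rw [inter_comm (Metric.ball (x _) (ρ i))]
      have h₁ : (0 : ℝ) ≤ if i ≤ j then 2 ^ i * ρ j else 0 := by split_ifs <;> positivity
      linarith [hone j i]
  refine (Finset.sum_le_sum fun i _ => Finset.sum_le_sum fun j _ => hpair i j).trans ?_
  have h₁ := sum_sum_ite_two_pow_le a b ρ fun j => (hρ j).le
  have h₂ := h₁
  rw [Finset.sum_comm] at h₂
  simp_rw [Finset.sum_add_distrib, ← Finset.mul_sum]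
  rw [← Finset.sum_mul, ← sq]
  linarith

/-- A tail of dyadic blocks of well spread intervals covers a definite proportion. -/
lemma le_measureReal_iUnion_ball (x : ℕ → ℝ) {δ Q : ℝ} (hδ : 0 < δ) (hδ₁ : δ < 1) (hQ : 0 < Q)
    (F : ℕ → Finset ℕ) (hF : ∀ j, InjOn (fun n => ⌊(2 ^ j : ℝ) / δ * |x n|⌋₊) (F j : Set ℕ))
    (hcard : ∀ j, (F j).card ≤ 2 ^ j) (ρ : ℕ → ℝ) (hρ : ∀ j, 0 < ρ j)
    (hρδ : ∀ j, ρ j ≤ δ / 2 ^ j) (hdiv : ¬ Summable fun j => 2 ^ j * ρ j) (a : ℕ)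
    (hlow : ∀ j, a ≤ j → Q / 2 * 2 ^ j ≤ (F j).card)
    (hfin : volume (⋃ j ≥ a, ⋃ n ∈ F j, Metric.ball (x n) (ρ j)) ≠ ⊤) :
    δ / 18 * Q ^ 2 ≤ volume.real (⋃ j ≥ a, ⋃ n ∈ F j, Metric.ball (x n) (ρ j)) := by
  have hnn : ∀ j, 0 ≤ 2 ^ j * ρ j := fun j => mul_nonneg (by positivity) (hρ j).le
  obtain ⟨b, hab, hb⟩ : ∃ b, a ≤ b ∧ 3 ≤ ∑ j ∈ Finset.Ico a b, 2 ^ j * ρ j := by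
    have h := (not_summable_iff_tendsto_nat_atTop_of_nonneg hnn).1 hdiv
    obtain ⟨b, hb, hab⟩ := ((h.eventually_ge_atTop
      (3 + ∑ j ∈ Finset.range a, 2 ^ j * ρ j)).and (eventually_ge_atTop a)).exists
    refine ⟨b, hab, ?_⟩
    rw [Finset.sum_Ico_eq_sub _ hab]
    linarith
  set S := ∑ j ∈ Finset.Ico a b, 2 ^ j * ρ j with hS
  set W := ⋃ j ≥ a, ⋃ n ∈ F j, Metric.ball (x n) (ρ j) with hW
  have hce := sq_sum_measureReal_le volume ((Finset.Ico a b).sigma F)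
    (fun p => Metric.ball (x p.2) (ρ p.1)) (fun _ _ => measurableSet_ball)
    (fun _ _ => measure_ball_lt_top.ne)
  have hsub : (⋃ p ∈ (Finset.Ico a b).sigma F, Metric.ball (x p.2) (ρ p.1)) ⊆ W := by
    refine iUnion₂_subset fun p hp => ?_
    rw [Finset.mem_sigma, Finset.mem_Ico] at hp
    exact fun τ hτ => mem_biUnion (show a ≤ p.1 from hp.1.1) (mem_biUnion hp.2 hτ)
  have hfirst : Q * S ≤ ∑ p ∈ (Finset.Ico a b).sigma F,
      volume.real (Metric.ball (x p.2) (ρ p.1)) := by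
    rw [Finset.sum_sigma, hS, Finset.mul_sum]
    refine Finset.sum_le_sum fun j hj => ?_
    simp_rw [Real.volume_real_ball (hρ j).le]
    rw [Finset.sum_const, nsmul_eq_mul]
    have := mul_le_mul_of_nonneg_right (hlow j (Finset.mem_Ico.1 hj).1) (hρ j).le
    linarith
  have hsecond : ∑ p ∈ (Finset.Ico a b).sigma F, ∑ p' ∈ (Finset.Ico a b).sigma F,
      volume.real (Metric.ball (x p.2) (ρ p.1) ∩ Metric.ball (x p'.2) (ρ p'.1)) ≤
        4 / δ * S ^ 2 + 32 * S := by
    refine le_of_eq_of_le ?_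
      (sum_sum_measureReal_ball_inter_le x hδ F hF hcard ρ hρ hρδ a b)
    simp_rw [Finset.sum_sigma]
    exact Finset.sum_congr rfl fun i _ => Finset.sum_comm
  have hmain : (Q * S) ^ 2 ≤ volume.real W * (4 / δ * S ^ 2 + 32 * S) := by
    calc (Q * S) ^ 2 ≤ _ := pow_le_pow_left₀ (by positivity) hfirst 2
      _ ≤ _ := hce
      _ ≤ _ := mul_le_mul (measureReal_mono hsub hfin) hsecond
        (Finset.sum_nonneg fun _ _ => Finset.sum_nonneg fun _ _ => measureReal_nonneg)
        measureReal_nonneg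
  have hSpos : 0 < S := by linarith
  have hbound : 4 / δ * S ^ 2 + 32 * S ≤ 18 / δ * S ^ 2 := by
    have : 32 * S ≤ 14 / δ * S ^ 2 := by
      rw [div_mul_eq_mul_div, le_div_iff₀ hδ]
      nlinarith
    have h18 : 18 / δ * S ^ 2 = 4 / δ * S ^ 2 + 14 / δ * S ^ 2 := by ring
    linarith
  have hmain' := hmain.trans (mul_le_mul_of_nonneg_left hbound measureReal_nonneg)
  have hQV : Q ^ 2 ≤ volume.real W * (18 / δ) := by
    refine le_of_mul_le_mul_right ?_ (pow_pos hSpos 2)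
    linarith
  calc δ / 18 * Q ^ 2 ≤ δ / 18 * (volume.real W * (18 / δ)) :=
        mul_le_mul_of_nonneg_left hQV (by positivity)
    _ = volume.real W := by field_simp

/-- A point lying in infinitely many of the sets `⋃ n ∈ F j, ball (x n) (ρ j)` and different from
every `x n` is within `r n` of `x n` for infinitely many `n`. -/
lemma frequently_abs_sub_lt (x r ρ : ℕ → ℝ) (F : ℕ → Finset ℕ)
    (hρ : Tendsto ρ atTop (nhds 0)) (hρr : ∀ j, ∀ n ∈ F j, ρ j ≤ r n) {τ : ℝ}
    (hτ : ∀ a, ∃ j ≥ a, ∃ n ∈ F j, |τ - x n| < ρ j) (hne : ∀ n, τ ≠ x n) :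
    ∃ᶠ n in atTop, |τ - x n| < r n := by
  rw [frequently_atTop]
  intro N
  have hev : ∀ᶠ j in atTop, ∀ n ∈ Finset.range N, ρ j < |τ - x n| :=
    (Finset.eventually_all _).2 fun n _ =>
      hρ.eventually (gt_mem_nhds (abs_pos.2 (sub_ne_zero.2 (hne n))))
  obtain ⟨a, ha⟩ := eventually_atTop.1 hev
  obtain ⟨j, hj, n, hn, hlt⟩ := hτ a
  refine ⟨n, ?_, hlt.trans_le (hρr j n hn)⟩
  by_contra hnN
  exact lt_asymm hlt (ha j hj n (Finset.mem_range.2 (not_le.1 hnN)))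

/-- One-dimensional key estimate: if `(r n)` is nonincreasing, positive, with divergent
sum, then the set `E` of points within `r n` of `x n` for infinitely many `n` satisfies
`ℒ¹(E ∩ (−δ,δ)) ≥ (δ/18) Q̲_δ²`, where `Q̲_δ` measures how homogeneously the points
`x n` are distributed around `0` at scale `δ`. -/
theorem stmt5 (x : ℕ → ℝ) (r : ℕ → ℝ)
    (hrpos : ∀ n : ℕ, 1 ≤ n → 0 < r n)
    (hrmono : ∀ m n : ℕ, 1 ≤ m → m ≤ n → r n ≤ r m)
    (hrdiv : ¬ Summable r)
    (δ : ℝ) (hδ : δ ∈ Set.Ioo (0 : ℝ) 1) :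
    ENNReal.ofReal (δ / 18 *
        (liminf
          (fun j : ℕ =>
            (Set.ncard {q : ℕ | q < 2 ^ j ∧ ∃ n : ℕ, 1 ≤ n ∧ n ≤ ⌊(2 ^ j : ℝ) / δ⌋₊ ∧
              q = ⌊(2 ^ j : ℝ) / δ * |x n|⌋₊} : ℝ) / 2 ^ j)
          atTop) ^ 2) ≤
      volume ({τ : ℝ | ∃ᶠ n in atTop, |τ - x n| < r n} ∩ Set.Ioo (-δ) δ) := by
  obtain ⟨hδ₀, hδ₁⟩ := hδ
  set u : ℕ → ℝ := fun j : ℕ =>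
    (Set.ncard {q : ℕ | q < 2 ^ j ∧ ∃ n : ℕ, 1 ≤ n ∧ n ≤ ⌊(2 ^ j : ℝ) / δ⌋₊ ∧
      q = ⌊(2 ^ j : ℝ) / δ * |x n|⌋₊} : ℝ) / 2 ^ j with hu
  set Q := liminf u atTop
  have hu₀ : ∀ j, 0 ≤ u j := fun j => by positivity
  have hu₁ : ∀ j, u j ≤ 1 := by
    intro j
    rw [hu]
    refine div_le_one_of_le₀ ?_ (by positivity)
    have h := Set.ncard_le_ncard (t := ((Finset.range (2 ^ j) : Finset ℕ) : Set ℕ))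
      (fun q (hq : q < 2 ^ j ∧ ∃ n : ℕ, 1 ≤ n ∧ n ≤ ⌊(2 ^ j : ℝ) / δ⌋₊ ∧
        q = ⌊(2 ^ j : ℝ) / δ * |x n|⌋₊) => Finset.mem_coe.2 (Finset.mem_range.2 hq.1))
      (Finset.finite_toSet _)
    rw [Set.ncard_coe_finset, Finset.card_range] at h
    exact_mod_cast h
  have hQ₀ : 0 ≤ Q := le_liminf_of_le
    (isBoundedUnder_of ⟨1, hu₁⟩).isCoboundedUnder_ge (Eventually.of_forall hu₀)
  rcases hQ₀.eq_or_lt with hQ | hQ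
  · simp [← hQ]
  obtain ⟨ρ, hρ, hρδ, hρr, hdiv⟩ := exists_dyadic_radii r hrpos hrmono hrdiv hδ₀
  choose F hFmem hFinj hFcard using fun j : ℕ =>
    exists_representatives x ((2 ^ j : ℝ) / δ) (2 ^ j) ⌊(2 ^ j : ℝ) / δ⌋₊
  have hcard : ∀ j, (F j).card ≤ 2 ^ j := by
    intro j
    have h := Finset.card_le_card_of_injOn (t := Finset.range (2 ^ j)) _
      (fun n hn => Finset.mem_coe.2 (Finset.mem_range.2 (by have := (hFmem j n hn).2.2; omega)))
      (hFinj j)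
    rwa [Finset.card_range] at h
  have hpow : Tendsto (fun j : ℕ => ((1 : ℝ) / 2) ^ j) atTop (nhds 0) :=
    tendsto_pow_atTop_nhds_zero_of_lt_one (by norm_num) (by norm_num)
  have hlow : ∀ᶠ j in atTop, Q / 2 * 2 ^ j ≤ ((F j).card : ℝ) := by
    have h₁ : ∀ᶠ j in atTop, Q * (3 / 4) < u j :=
      eventually_lt_of_lt_liminf (by linarith) (isBoundedUnder_of ⟨0, hu₀⟩)
    have h₂ : ∀ᶠ j : ℕ in atTop, ((1 : ℝ) / 2) ^ j < Q / 4 :=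
      hpow.eventually (gt_mem_nhds (by linarith))
    filter_upwards [h₁, h₂] with j hj₁ hj₂
    have h2j : (0 : ℝ) < 2 ^ j := by positivity
    rw [hu, lt_div_iff₀ h2j] at hj₁
    rw [one_div_pow, div_lt_iff₀ h2j] at hj₂
    have h₃ : (Set.ncard {q : ℕ | q < 2 ^ j ∧ ∃ n : ℕ, 1 ≤ n ∧ n ≤ ⌊(2 ^ j : ℝ) / δ⌋₊ ∧
      q = ⌊(2 ^ j : ℝ) / δ * |x n|⌋₊} : ℝ) ≤ (F j).card + 1 := by exact_mod_cast hFcard j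
    linarith
  obtain ⟨a₀, ha₀⟩ := eventually_atTop.1 hlow
  set W : ℕ → Set ℝ := fun a => ⋃ j ≥ a + a₀, ⋃ n ∈ F j, Metric.ball (x n) (ρ j) with hW
  have hmemW : ∀ {a τ}, τ ∈ W a ↔ ∃ j ≥ a + a₀, ∃ n ∈ F j, |τ - x n| < ρ j := by
    intro a τ
    simp [hW, Real.dist_eq]
  have hWsub : ∀ a, W a ⊆ Ioo (-δ) δ := by
    intro a τ hτ
    obtain ⟨j, -, n, hn, hlt⟩ := hmemW.1 hτ
    have h2j : (0 : ℝ) < 2 ^ j := by positivity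
    have hq : ((⌊(2 ^ j : ℝ) / δ * |x n|⌋₊ : ℝ) + 1) + 1 ≤ 2 ^ j := by
      exact_mod_cast (hFmem j n hn).2.2
    have hlt' := Nat.lt_floor_add_one ((2 ^ j : ℝ) / δ * |x n|)
    have hx : |x n| + δ / 2 ^ j < δ := by
      have h₁ : (2 ^ j : ℝ) / δ * |x n| < 2 ^ j - 1 := by linarith
      rw [div_mul_eq_mul_div, div_lt_iff₀ hδ₀] at h₁
      have h₂ : |x n| < (2 ^ j - 1) * δ / 2 ^ j := by
        rw [lt_div_iff₀ h2j]
        linarith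
      have h₃ : (2 ^ j - 1) * δ / 2 ^ j = δ - δ / 2 ^ j := by field_simp
      linarith
    have htri : |τ| ≤ |τ - x n| + |x n| := by simpa using abs_add_le (τ - x n) (x n)
    exact abs_lt.1 (by linarith [hρδ j])
  have hWfin : ∀ a, volume (W a) ≠ ⊤ := fun a =>
    measure_ne_top_of_subset (hWsub a) measure_Ioo_lt_top.ne
  have hWmeas : ∀ a, MeasurableSet (W a) := fun a =>
    (isOpen_biUnion fun j _ => isOpen_biUnion fun n _ => Metric.isOpen_ball).measurableSet
  have hWle : ∀ a, ENNReal.ofReal (δ / 18 * Q ^ 2) ≤ volume (W a) := by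
    intro a
    refine (ENNReal.ofReal_le_iff_le_toReal (hWfin a)).2 ?_
    exact le_measureReal_iUnion_ball x hδ₀ hδ₁ hQ F hFinj hcard ρ hρ hρδ hdiv (a + a₀)
      (fun j hj => ha₀ j (le_trans (Nat.le_add_left _ _) hj)) (hWfin a)
  have hWanti : Antitone W := fun a b hab => biUnion_subset_biUnion_left fun j (hj : b + a₀ ≤ j) =>
    (Nat.add_le_add_right hab a₀).trans hj
  have hinter : ENNReal.ofReal (δ / 18 * Q ^ 2) ≤ volume (⋂ a, W a) :=
    ge_of_tendsto' (tendsto_measure_iInter_atTop (fun a => (hWmeas a).nullMeasurableSet) hWanti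
      ⟨0, hWfin 0⟩) hWle
  have hρ₀ : Tendsto ρ atTop (nhds 0) := by
    refine squeeze_zero (fun j => (hρ j).le) hρδ ?_
    simpa [div_eq_mul_inv] using hpow.const_mul δ
  rw [← measure_sdiff_null ((countable_range x).measure_zero volume)] at hinter
  refine hinter.trans (measure_mono ?_)
  rintro τ ⟨hτ, hτx⟩
  rw [mem_iInter] at hτ
  refine ⟨frequently_abs_sub_lt x r ρ F hρ₀ (fun j n hn => hρr j n (hFmem j n hn).1
    (hFmem j n hn).2.1) (fun a => ?_) fun n h => hτx ⟨n, h.symm⟩, hWsub 0 (hτ 0)⟩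
  obtain ⟨j, hj, h⟩ := hmemW.1 (hτ a)
  exact ⟨j, le_trans (Nat.le_add_right _ _) hj, h⟩
end

section
/- Work in ℝ^d (d ≥ 1) with the Euclidean inner product ⟨·,·⟩ and norm ‖·‖. Let g be a gauge function, let A ≥ 1 be a real number, let (ρ_n, s_n)_{n≥1} be a sequence of pairs with ρ_n ∈ ℝ and s_n a unit vector of ℝ^d, and let (R_n)_{n≥1} be a sequence in (0,1] with Σ_{n≥1} g(R_n) < ∞. Then the set K = { t ∈ ℝ^d : ‖t‖ < A and |ρ_n − ⟨s_n, t⟩| < R_n for infinitely many n ≥ 1 } has zero Hausdorff measure with respect to the gauge r ↦ r^{d−1} g(r), i.e., ℋ^{d−1,g}(K) = 0. -/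
open MeasureTheory Filter Set
open scoped RealInnerProductSpace ENNReal

/-- The part of a slab of half-width `R` inside a ball of radius `A` is covered by at most
a constant times `R ^ (-e)` sets of diameter at most `R`, in dimension `e + 1`. -/
lemma exists_cover_slab (e : ℕ) (A : ℝ) (hA : 1 ≤ A) (ρ : ℝ)
    (s : EuclideanSpace ℝ (Fin (e + 1))) (hs : ‖s‖ = 1) (R : ℝ) (hR : R ∈ Set.Ioc (0 : ℝ) 1) :
    ∃ (F : Finset (Fin (e + 1) → ℤ))
      (c : (Fin (e + 1) → ℤ) → Set (EuclideanSpace ℝ (Fin (e + 1)))),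
      (F.card : ℝ) * R ^ e ≤ (2 * (e + 1) + 2) * (2 * A * (e + 1) + 2) ^ e ∧
      (∀ k, Metric.ediam (c k) ≤ ENNReal.ofReal R) ∧
      {t | ‖t‖ < A ∧ |ρ - ⟪s, t⟫| < R} ⊆ ⋃ k : F, c k := by
  obtain ⟨hR0, hR1⟩ := hR
  obtain ⟨b, hb⟩ : ∃ b : OrthonormalBasis (Fin (e + 1)) ℝ (EuclideanSpace ℝ (Fin (e + 1))),
      ∀ i ∈ ({0} : Set (Fin (e + 1))), b i = s :=
    Orthonormal.exists_orthonormalBasis_extension_of_card_eq (v := fun _ => s) (by simp)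
      ⟨fun _ => hs, fun i j hij => (hij (Subsingleton.elim i j)).elim⟩
  have hb0 : b 0 = s := hb 0 rfl
  set h : ℝ := R / (e + 1) with hh
  have he : (0 : ℝ) < e + 1 := by positivity
  have hh0 : 0 < h := by positivity
  have hcard : ∀ x y : ℝ, x ≤ y → ((Finset.Icc ⌊x / h⌋ ⌊y / h⌋).card : ℝ) ≤ (y - x) / h + 2 := by
    intro x y hxy
    have hfl : ⌊x / h⌋ ≤ ⌊y / h⌋ := Int.floor_le_floor (by gcongr)
    have h1 : ((Finset.Icc ⌊x / h⌋ ⌊y / h⌋).card : ℤ) = ⌊y / h⌋ + 1 - ⌊x / h⌋ := by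
      rw [Int.card_Icc, Int.toNat_of_nonneg (by linarith)]
    have h2 : ((Finset.Icc ⌊x / h⌋ ⌊y / h⌋).card : ℝ) = ⌊y / h⌋ + 1 - ⌊x / h⌋ := by
      exact_mod_cast h1
    rw [h2, sub_div]
    linarith [Int.floor_le (y / h), Int.lt_floor_add_one (x / h)]
  refine ⟨Fintype.piFinset (Fin.cons (Finset.Icc ⌊(ρ - R) / h⌋ ⌊(ρ + R) / h⌋)
      fun _ => Finset.Icc ⌊-A / h⌋ ⌊A / h⌋),
    fun k => {t | ∀ i, ⌊b.repr t i / h⌋ = k i}, ?_, ?_, ?_⟩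
  · rw [Fintype.card_piFinset, Fin.prod_univ_succ]
    simp only [Fin.cons_zero, Fin.cons_succ, Finset.prod_const, Finset.card_univ,
      Fintype.card_fin, Nat.cast_mul, Nat.cast_pow]
    rw [mul_assoc, ← mul_pow]
    gcongr
    · refine (hcard _ _ (by linarith)).trans (le_of_eq ?_)
      rw [hh]
      field_simp
      ring
    · calc ((Finset.Icc ⌊-A / h⌋ ⌊A / h⌋).card : ℝ) * R
          ≤ ((A - -A) / h + 2) * R := by
            gcongr
            exact hcard _ _ (by linarith)
        _ = 2 * A * (e + 1) + 2 * R := by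
            rw [hh]
            field_simp
            ring
        _ ≤ 2 * A * (e + 1) + 2 := by linarith
  · intro k
    refine Metric.ediam_le fun x hx y hy => ?_
    rw [edist_dist]
    refine ENNReal.ofReal_le_ofReal ?_
    rw [← b.repr.dist_map, EuclideanSpace.dist_eq]
    refine Real.sqrt_le_iff.2 ⟨hR0.le, ?_⟩
    calc ∑ i, dist (b.repr x i) (b.repr y i) ^ 2
        ≤ ∑ _i : Fin (e + 1), h ^ 2 := by
          refine Finset.sum_le_sum fun i _ => ?_
          gcongr
          have h1 := Int.abs_sub_lt_one_of_floor_eq_floor ((hx i).trans (hy i).symm)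
          rw [← sub_div, abs_div, abs_of_pos hh0, div_lt_one hh0] at h1
          exact h1.le
      _ = R ^ 2 / (e + 1) := by
          simp only [Finset.sum_const, Finset.card_univ, Fintype.card_fin, nsmul_eq_mul,
            Nat.cast_add, Nat.cast_one, hh]
          field_simp
      _ ≤ R ^ 2 := div_le_self (by positivity) (by linarith [Nat.cast_nonneg (α := ℝ) e])
  · rintro t ⟨htA, htR⟩
    refine mem_iUnion.2 ⟨⟨fun i => ⌊b.repr t i / h⌋, ?_⟩, fun i => rfl⟩
    refine Fintype.mem_piFinset.2 fun i => ?_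
    refine Fin.cases ?_ (fun j => ?_) i
    · rw [abs_lt] at htR
      rw [Fin.cons_zero, Finset.mem_Icc, b.repr_apply_apply, hb0]
      constructor <;> apply Int.floor_le_floor <;> gcongr <;> linarith
    · have h1 : |b.repr t j.succ| ≤ A := by
        rw [b.repr_apply_apply]
        refine (abs_real_inner_le_norm _ _).trans ?_
        rw [b.norm_eq_one, one_mul]
        exact htA.le
      rw [abs_le] at h1
      rw [Fin.cons_succ, Finset.mem_Icc]
      constructor <;> apply Int.floor_le_floor <;> gcongr <;> linarith

/-- If `Σ_n g(R n) < ∞`, then the set of points of the ball of radius `A` lying within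
distance `R n` of the hyperplane `{t : ρ n = ⟪s n, t⟫}` for infinitely many `n` is null
for the Hausdorff measure associated with the gauge `r ↦ r^{d−1} g(r)`. -/
theorem stmt8 (d : ℕ) (hd : 1 ≤ d) (g : ℝ → ℝ) (hg : IsGauge g)
    (A : ℝ) (hA : 1 ≤ A)
    (ρ : ℕ → ℝ) (s : ℕ → EuclideanSpace ℝ (Fin d)) (hs : ∀ n, ‖s n‖ = 1)
    (R : ℕ → ℝ) (hR : ∀ n, R n ∈ Set.Ioc (0 : ℝ) 1)
    (hsum : Summable (fun n => g (R n))) :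
    Measure.mkMetric (fun t : ℝ≥0∞ => t ^ (d - 1) * ENNReal.ofReal (g t.toReal))
      {t : EuclideanSpace ℝ (Fin d) | ‖t‖ < A ∧
        ∃ᶠ n in atTop, |ρ n - ⟪s n, t⟫| < R n} = 0 := by
  obtain ⟨e, rfl⟩ : ∃ e, d = e + 1 := ⟨d - 1, by omega⟩
  obtain ⟨hmono, hg0, -, hpos, hanti⟩ := hg
  rw [Nat.add_sub_cancel]
  have hg1 : 0 < g 1 := by simpa using hpos 1 (by simp)
  have hgnn : ∀ r, 0 ≤ r → 0 ≤ g r := fun r hr => hg0 ▸ hmono self_mem_Ici hr hr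
  have hRg : ∀ n, R n ≤ (g 1)⁻¹ * g (R n) := by
    intro n
    have h1 : g 1 / 1 ≤ g (R n) / R n := hanti (hR n) (by simp) (hR n).2
    rw [div_one, le_div_iff₀ (hR n).1] at h1
    rwa [inv_mul_eq_div, le_div_iff₀' hg1]
  choose F c hcard hdiam hcov using
    fun n => exists_cover_slab e A hA (ρ n) (s n) (hs n) (R n) (hR n)
  set C : ℝ := (2 * (e + 1) + 2) * (2 * A * (e + 1) + 2) ^ e
  set T : ℕ → ℝ≥0∞ := fun N => ∑' n, ENNReal.ofReal (g (R (n + N))) with hT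
  have hTlim : Tendsto T atTop (nhds 0) :=
    ENNReal.tendsto_sum_nat_add (fun n => ENNReal.ofReal (g (R n))) hsum.tsum_ofReal_ne_top
  have hmul : ∀ a : ℝ, Tendsto (fun N => ENNReal.ofReal a * T N) atTop (nhds 0) := by
    intro a
    simpa using ENNReal.Tendsto.const_mul hTlim (Or.inr ENNReal.ofReal_ne_top)
  have hcell : ∀ n k, Metric.ediam (c n k) ^ e *
      ENNReal.ofReal (g (Metric.ediam (c n k)).toReal) ≤
        ENNReal.ofReal (R n) ^ e * ENNReal.ofReal (g (R n)) := by
    intro n k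
    gcongr
    · exact hdiam n k
    · exact hmono ENNReal.toReal_nonneg (hR n).1.le
        (ENNReal.toReal_le_of_le_ofReal (hR n).1.le (hdiam n k))
  have hbound : ∀ N, (∑' p : Σ n : ℕ, F (n + N), Metric.ediam (c (p.1 + N) p.2) ^ e *
      ENNReal.ofReal (g (Metric.ediam (c (p.1 + N) p.2)).toReal)) ≤ ENNReal.ofReal C * T N := by
    intro N
    rw [ENNReal.tsum_sigma', hT, ← ENNReal.tsum_mul_left]
    refine ENNReal.tsum_le_tsum fun n => ?_
    refine (ENNReal.tsum_le_tsum fun k : F (n + N) => hcell (n + N) k).trans ?_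
    rw [tsum_fintype, Finset.sum_const, Finset.card_univ, Fintype.card_coe, nsmul_eq_mul,
      ← mul_assoc]
    gcongr
    rw [← ENNReal.ofReal_natCast, ← ENNReal.ofReal_pow (hR _).1.le,
      ← ENNReal.ofReal_mul (Nat.cast_nonneg _)]
    exact ENNReal.ofReal_le_ofReal (hcard _)
  have hle := Measure.mkMetric_le_liminf_tsum
    {t : EuclideanSpace ℝ (Fin (e + 1)) | ‖t‖ < A ∧ ∃ᶠ n in atTop, |ρ n - ⟪s n, t⟫| < R n}
    (fun N => ENNReal.ofReal (g 1)⁻¹ * T N) (hmul _)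
    (fun N (p : Σ n : ℕ, F (n + N)) => c (p.1 + N) p.2)
    (Eventually.of_forall fun N p => ?_) (Eventually.of_forall fun N t ht => ?_)
    (fun t : ℝ≥0∞ => t ^ e * ENNReal.ofReal (g t.toReal))
  · refine le_antisymm (hle.trans ?_) zero_le
    exact (tendsto_of_tendsto_of_tendsto_of_le_of_le tendsto_const_nhds (hmul C)
      (fun _ => zero_le) hbound).liminf_eq.le
  · calc Metric.ediam (c (p.1 + N) p.2) ≤ ENNReal.ofReal (R (p.1 + N)) := hdiam _ _
      _ ≤ ENNReal.ofReal ((g 1)⁻¹ * g (R (p.1 + N))) := ENNReal.ofReal_le_ofReal (hRg _)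
      _ = ENNReal.ofReal (g 1)⁻¹ * ENNReal.ofReal (g (R (p.1 + N))) :=
          ENNReal.ofReal_mul (inv_nonneg.2 hg1.le)
      _ ≤ ENNReal.ofReal (g 1)⁻¹ * T N := by
          gcongr
          exact ENNReal.le_tsum (f := fun n => ENNReal.ofReal (g (R (n + N)))) p.1
  · obtain ⟨n, hn, htn⟩ := frequently_atTop.1 ht.2 N
    obtain ⟨m, rfl⟩ := Nat.exists_eq_add_of_le' hn
    obtain ⟨k, hk⟩ := mem_iUnion.1 (hcov (m + N) ⟨ht.1, htn⟩)
    exact mem_iUnion.2 ⟨⟨m, k⟩, hk⟩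
end

section
/- Work in ℝ^d (d ≥ 1) with the Euclidean inner product and norm. Let A ≥ 1 be a real number, let ρ ∈ ℝ, let s be a unit vector of ℝ^d, and let R ∈ (0,1]. Then the slab { t ∈ ℝ^d : ‖t‖ ≤ A and |ρ − ⟨s, t⟩| < R } can be covered by at most (3⌊2A√d/R⌋)^{d−1} open Euclidean balls of radius 2R. -/
open Set
open scoped RealInnerProductSpace

/-- The `N` left endpoints of the uniform subdivision of `[-A, A]` form a `2A/N`-net. -/
lemma exists_fin_abs_sub_le {A : ℝ} (hA : 0 < A) {N : ℕ} (hN : 0 < N) {x : ℝ} (hx : |x| ≤ A) :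
    ∃ j : Fin N, |x - (-A + 2 * A / N * j)| ≤ 2 * A / N := by
  have hN' : (0 : ℝ) < N := by exact_mod_cast hN
  obtain ⟨h1, h2⟩ := abs_le.1 hx
  have hh : 0 < 2 * A / N := by positivity
  set h := 2 * A / N with hdef
  have hy0 : 0 ≤ (x + A) / h := div_nonneg (by linarith) hh.le
  have hyN : (x + A) / h ≤ N := by
    rw [div_le_iff₀ hh, hdef, mul_div_cancel₀ _ hN'.ne']
    linarith
  have hxy : x = -A + h * ((x + A) / h) := by
    rw [mul_div_cancel₀ _ hh.ne']
    ring
  set y := (x + A) / h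
  have hc : ⌈y⌉₊ ≤ N := Nat.ceil_le.2 hyN
  refine ⟨⟨⌈y⌉₊ - 1, by lia⟩, ?_⟩
  have hj : |y - ((⌈y⌉₊ - 1 : ℕ) : ℝ)| ≤ 1 := by
    have hle := Nat.le_ceil y
    have hlt := Nat.ceil_lt_add_one hy0
    rcases Nat.eq_zero_or_pos ⌈y⌉₊ with h0 | h0
    · rw [h0] at hle ⊢
      rw [abs_le]
      constructor <;> push_cast at hle ⊢ <;> linarith
    · rw [Nat.cast_pred h0, abs_le]
      constructor <;> linarith
  calc |x - (-A + h * ((⌈y⌉₊ - 1 : ℕ) : ℝ))|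
      = |h * (y - ((⌈y⌉₊ - 1 : ℕ) : ℝ))| := by
        congr 1
        linear_combination hxy
    _ = h * |y - ((⌈y⌉₊ - 1 : ℕ) : ℝ)| := by rw [abs_mul, abs_of_pos hh]
    _ ≤ h := mul_le_of_le_one_right hh.le hj

lemma le_three_mul_floor {x : ℝ} (hx : 1 ≤ x) : x ≤ (3 * ⌊x⌋₊ : ℕ) := by
  have h1 : (1 : ℝ) ≤ ⌊x⌋₊ := by exact_mod_cast Nat.le_floor (by simpa using hx)
  have h2 := Nat.lt_floor_add_one x
  push_cast
  linarith

/-- A unit vector is the first vector of some orthonormal basis. -/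
lemma exists_orthonormalBasis_apply_zero_eq {n : ℕ} {s : EuclideanSpace ℝ (Fin (n + 1))}
    (hs : ‖s‖ = 1) :
    ∃ b : OrthonormalBasis (Fin (n + 1)) ℝ (EuclideanSpace ℝ (Fin (n + 1))), b 0 = s := by
  have hv : Orthonormal ℝ (({0} : Set (Fin (n + 1))).domRestrict fun _ => s) :=
    ⟨fun _ => hs, fun i j hij => (hij (Subsingleton.elim i j)).elim⟩
  obtain ⟨b, hb⟩ := hv.exists_orthonormalBasis_extension_of_card_eq (by simp)
  exact ⟨b, hb 0 rfl⟩

/-- Covering estimate: the intersection of the closed ball of radius `A` with the open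
`R`-neighborhood of the hyperplane `{t : ρ = ⟪s, t⟫}` can be covered by at most
`(3⌊2A√d/R⌋)^{d−1}` open Euclidean balls of radius `2R`. -/
theorem stmt9 (d : ℕ) (hd : 1 ≤ d) (A : ℝ) (hA : 1 ≤ A) (ρ : ℝ)
    (s : EuclideanSpace ℝ (Fin d)) (hs : ‖s‖ = 1)
    (R : ℝ) (hR : R ∈ Set.Ioc (0 : ℝ) 1) :
    ∃ C : Finset (EuclideanSpace ℝ (Fin d)),
      C.card ≤ (3 * ⌊2 * A * Real.sqrt d / R⌋₊) ^ (d - 1) ∧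
      {t : EuclideanSpace ℝ (Fin d) | ‖t‖ ≤ A ∧ |ρ - ⟪s, t⟫| < R} ⊆
        ⋃ c ∈ C, Metric.ball c (2 * R) := by
  classical
  obtain ⟨n, rfl⟩ : ∃ n, d = n + 1 := ⟨d - 1, by lia⟩
  obtain ⟨hR0, hR1⟩ := hR
  obtain ⟨b, hb⟩ := exists_orthonormalBasis_apply_zero_eq hs
  have hA0 : 0 < A := by linarith
  have hsqrt : 1 ≤ √((n + 1 : ℕ) : ℝ) := Real.one_le_sqrt.2 (by simp)
  have hsqrt0 : 0 < √((n + 1 : ℕ) : ℝ) := by linarith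
  have hx : 1 ≤ 2 * A * √((n + 1 : ℕ) : ℝ) / R := by
    rw [le_div_iff₀ hR0]
    nlinarith
  have hxN := le_three_mul_floor hx
  set N := 3 * ⌊2 * A * √((n + 1 : ℕ) : ℝ) / R⌋₊
  have hN' : (0 : ℝ) < N := by linarith
  have hN : 0 < N := by exact_mod_cast hN'
  have hmesh : 2 * A / N ≤ R / √((n + 1 : ℕ) : ℝ) := by
    rw [div_le_iff₀ hR0] at hxN
    rw [div_le_div_iff₀ hN' hsqrt0]
    linarith
  let center : (Fin n → Fin N) → EuclideanSpace ℝ (Fin (n + 1)) := fun f =>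
    b.repr.symm (WithLp.toLp 2 (Fin.cons ρ fun i => -A + 2 * A / N * (f i : ℕ)))
  refine ⟨Finset.univ.image center, Finset.card_image_le.trans (by simp), ?_⟩
  rintro t ⟨htA, htR⟩
  have hcoord (i : Fin n) : |b.repr t i.succ| ≤ A := by
    have h := PiLp.norm_apply_le (b.repr t) i.succ
    rw [b.repr.norm_map] at h
    exact h.trans htA
  choose f hf using fun i => exists_fin_abs_sub_le hA0 hN (hcoord i)
  simp only [mem_iUnion, Finset.mem_image, Finset.mem_univ, true_and, exists_prop]
  refine ⟨center f, ⟨f, rfl⟩, ?_⟩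
  rw [Metric.mem_ball, ← b.repr.dist_map, LinearIsometryEquiv.apply_symm_apply,
    EuclideanSpace.dist_eq, Real.sqrt_lt' (by positivity), Fin.sum_univ_succ]
  simp only [Fin.cons_zero, Fin.cons_succ, Real.dist_eq]
  have h0 : |b.repr t 0 - ρ| ^ 2 < R ^ 2 := by
    rw [b.repr_apply_apply, hb, abs_sub_comm]
    gcongr
  have hsum : ∑ i : Fin n, |b.repr t i.succ - (-A + 2 * A / N * (f i : ℕ))| ^ 2 ≤ R ^ 2 :=
    calc _ ≤ ∑ _i : Fin n, (R / √((n + 1 : ℕ) : ℝ)) ^ 2 := by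
            gcongr with i
            exact (hf i).trans hmesh
      _ = R ^ 2 * (n / (n + 1)) := by
            rw [Finset.sum_const, Finset.card_univ, Fintype.card_fin, nsmul_eq_mul, div_pow,
              Real.sq_sqrt (by positivity)]
            push_cast
            ring
      _ ≤ R ^ 2 := mul_le_of_le_one_right (by positivity)
            (div_le_one_of_le₀ (by linarith) (by positivity))
  nlinarith
end

section
/- Let (ν_j)_{j≥1} be a sequence of nonnegative reals and suppose there exists γ ∈ [0,2) such that Σ_{j≥1} 2^{−γj} ν_j < ∞. Then Σ_{j≥1} 2^{−j} (j ν_j)^{1/2} < ∞. -/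
/-- Every Lévy measure with index `< 2` is admissible: if `Σ_j 2^{−γj} ν_j < ∞` for some
`γ ∈ [0,2)`, then `Σ_j 2^{−j} (j ν_j)^{1/2} < ∞`. -/
theorem stmt11 (ν : ℕ → ℝ) (hν : ∀ j, 0 ≤ ν j)
    (γ : ℝ) (hγ0 : 0 ≤ γ) (hγ2 : γ < 2)
    (hsum : Summable (fun j : ℕ => (2 : ℝ) ^ (-(γ * j)) * ν j)) :
    Summable (fun j : ℕ => (2 : ℝ) ^ (-(j : ℝ)) * Real.sqrt (j * ν j)) := by
  have hr0 : (0 : ℝ) ≤ 2 ^ (γ - 2) := by positivity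
  have hr1 : (2 : ℝ) ^ (γ - 2) < 1 :=
    Real.rpow_lt_one_of_one_lt_of_neg one_lt_two (by linarith)
  have hgeom : Summable (fun j : ℕ => (j : ℝ) * ((2 : ℝ) ^ (γ - 2)) ^ j) := by
    simpa using summable_pow_mul_geometric_of_norm_lt_one 1
      (r := (2 : ℝ) ^ (γ - 2)) (by rwa [Real.norm_of_nonneg hr0])
  refine Summable.of_nonneg_of_le (fun j => by positivity) (fun j => ?_) (hsum.add hgeom)
  have ha : 0 ≤ (2 : ℝ) ^ (-(γ * j)) * ν j := mul_nonneg (by positivity) (hν j)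
  have hb : 0 ≤ (j : ℝ) * ((2 : ℝ) ^ (γ - 2)) ^ j := by positivity
  refine abs_le_of_sq_le_sq' ?_ (add_nonneg ha hb) |>.2
  have hpow : ((2 : ℝ) ^ (-(j : ℝ))) ^ 2 = 2 ^ (-(γ * j)) * ((2 : ℝ) ^ (γ - 2)) ^ j := by
    rw [← Real.rpow_mul_natCast zero_le_two, ← Real.rpow_mul_natCast zero_le_two,
      ← Real.rpow_add two_pos]
    congr 1
    push_cast
    ring
  have hsq : ((2 : ℝ) ^ (-(j : ℝ)) * √(j * ν j)) ^ 2
      = (2 ^ (-(γ * j)) * ν j) * (j * ((2 : ℝ) ^ (γ - 2)) ^ j) := by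
    rw [mul_pow, Real.sq_sqrt (mul_nonneg j.cast_nonneg (hν j)), hpow]
    ring
  rw [hsq]
  nlinarith [mul_nonneg ha hb]
end

section
/- Let d ≥ 1, let μ be a finite nonnegative Borel measure on the unit sphere 𝕊^{d−1} of ℝ^d with μ(𝕊^{d−1}) > 0, set c_μ = (μ(𝕊^{d−1})/2)^{1/2} and 𝔡_μ(t,t') = ( (1/2) ∫_{𝕊^{d−1}} |⟨s, t'−t⟩| μ(ds) )^{1/2}, and let A ≥ 1 be an integer. Then for every ε > 0 there exists a finite set F ⊆ [−A,A]^d of cardinality at most (1 + 2⌊A (c_μ/ε)² √d⌋)^d such that for every t ∈ [−A,A]^d there is u ∈ F with 𝔡_μ(t,u) ≤ ε. -/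
open MeasureTheory
open scoped RealInnerProductSpace

/-- The midpoints of `N` consecutive intervals of equal length subdividing `[-a, a]`. -/
noncomputable def gridPoint (a : ℝ) (N : ℕ) (k : Fin N) : ℝ :=
  -a + (2 * (k : ℝ) + 1) * (a / N)

theorem gridPoint_mem_Icc {a : ℝ} (ha : 0 ≤ a) {N : ℕ} (k : Fin N) :
    gridPoint a N k ∈ Set.Icc (-a) a := by
  have hN : (0 : ℝ) < N := by exact_mod_cast k.pos
  have hk : (k : ℝ) + 1 ≤ N := by exact_mod_cast k.isLt
  have hr : 0 ≤ a / N := by positivity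
  have ha' : N * (a / N) = a := by field_simp
  unfold gridPoint
  constructor
  · have : 0 ≤ (2 * (k : ℝ) + 1) * (a / N) := by positivity
    linarith
  · nlinarith

theorem exists_abs_gridPoint_sub_le {a : ℝ} (ha : 0 < a) {N : ℕ} (hN : 0 < N) {x : ℝ}
    (hx : x ∈ Set.Icc (-a) a) : ∃ k : Fin N, |gridPoint a N k - x| ≤ a / N := by
  have hN' : (0 : ℝ) < N := by exact_mod_cast hN
  obtain ⟨hx₁, hx₂⟩ := hx
  set r := a / N with hr
  have hr0 : 0 < r := by positivity
  have hNr : N * r = a := by rw [hr]; field_simp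
  rcases hx₂.eq_or_lt with rfl | hx₂
  · refine ⟨⟨N - 1, by omega⟩, ?_⟩
    have : ((N - 1 : ℕ) : ℝ) = N - 1 := by rw [Nat.cast_sub hN, Nat.cast_one]
    unfold gridPoint
    rw [← hr, abs_le]
    simp only [this]
    constructor <;> nlinarith
  · have hy : 0 ≤ (x + a) / (2 * r) := div_nonneg (by linarith) (by positivity)
    have hxy : (x + a) / (2 * r) * (2 * r) = x + a := by field_simp
    have hlt : (x + a) / (2 * r) < N := by
      rw [div_lt_iff₀ (by positivity)]
      linarith
    refine ⟨⟨⌊(x + a) / (2 * r)⌋₊, (Nat.floor_lt hy).2 hlt⟩, ?_⟩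
    have h₁ := Nat.floor_le hy
    have h₂ := Nat.lt_floor_add_one ((x + a) / (2 * r))
    unfold gridPoint
    rw [← hr, abs_le]
    constructor <;> dsimp only <;> nlinarith

theorem EuclideanSpace.norm_le_sqrt_card_mul {ι : Type*} [Fintype ι] (v : EuclideanSpace ℝ ι)
    {r : ℝ} (hr : 0 ≤ r) (h : ∀ i, |v i| ≤ r) : ‖v‖ ≤ √(Fintype.card ι) * r := by
  rw [EuclideanSpace.norm_eq, Real.sqrt_le_left (by positivity), mul_pow,
    Real.sq_sqrt (Nat.cast_nonneg _)]
  calc ∑ i, ‖v i‖ ^ 2 ≤ ∑ _i : ι, r ^ 2 :=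
        Finset.sum_le_sum fun i _ => pow_le_pow_left₀ (norm_nonneg _) (h i) 2
    _ = Fintype.card ι * r ^ 2 := by simp

theorem integral_abs_inner_sphere_le {E : Type*} [NormedAddCommGroup E] [InnerProductSpace ℝ E]
    [MeasurableSpace E] (μ : Measure (Metric.sphere (0 : E) 1)) [IsFiniteMeasure μ] (v : E) :
    ∫ s, |⟪(s : E), v⟫| ∂μ ≤ ‖v‖ * (μ Set.univ).toReal := by
  have hbound (s : Metric.sphere (0 : E) 1) : ‖|⟪(s : E), v⟫|‖ ≤ ‖v‖ := by
    have hs : ‖(s : E)‖ = 1 := by simp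
    simpa [hs] using abs_real_inner_le_norm (s : E) v
  exact (le_abs_self _).trans
    (norm_integral_le_of_norm_le_const (μ := μ) (.of_forall hbound))

/-- Entropy estimate: the cube `[−A,A]^d` can be covered by at most
`(1 + 2⌊A(c_μ/ε)²√d⌋)^d` balls of radius `ε` for the pseudometric
`𝔡_μ(t,u) = ((1/2)∫ |⟪s, u−t⟫| μ(ds))^{1/2}`, centered in the cube,
where `c_μ = (μ(𝕊^{d−1})/2)^{1/2}`. -/
theorem stmt14 (d : ℕ) (hd : 1 ≤ d)
    (μ : Measure (Metric.sphere (0 : EuclideanSpace ℝ (Fin d)) 1))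
    [IsFiniteMeasure μ] (hμpos : 0 < μ Set.univ)
    (A : ℕ) (hA : 1 ≤ A) (ε : ℝ) (hε : 0 < ε) :
    ∃ F : Finset (EuclideanSpace ℝ (Fin d)),
      (↑F : Set (EuclideanSpace ℝ (Fin d))) ⊆
        {t | ∀ i, t i ∈ Set.Icc (-(A : ℝ)) (A : ℝ)} ∧
      F.card ≤
        (1 + 2 * ⌊(A : ℝ) * (Real.sqrt ((μ Set.univ).toReal / 2) / ε) ^ 2 *
          Real.sqrt d⌋₊) ^ d ∧
      ∀ t : EuclideanSpace ℝ (Fin d), (∀ i, t i ∈ Set.Icc (-(A : ℝ)) (A : ℝ)) →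
        ∃ u ∈ F,
          Real.sqrt ((1 / 2) *
            ∫ s, |⟪(s : EuclideanSpace ℝ (Fin d)), u - t⟫| ∂μ) ≤ ε := by
  classical
  set M := (μ Set.univ).toReal
  have hM : 0 ≤ M := ENNReal.toReal_nonneg
  have hA' : (0 : ℝ) < A := by exact_mod_cast hA
  have hc : (Real.sqrt (M / 2) / ε) ^ 2 = M / 2 / ε ^ 2 := by
    rw [div_pow, Real.sq_sqrt (by positivity)]
  set x := (A : ℝ) * (Real.sqrt (M / 2) / ε) ^ 2 * Real.sqrt d with hx
  set N := 1 + 2 * ⌊x⌋₊ with hN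
  have hNpos : 0 < N := by omega
  have hxN : x ≤ N := by
    have := Nat.lt_floor_add_one x
    have h0 : (0 : ℝ) ≤ ⌊x⌋₊ := Nat.cast_nonneg _
    rw [hN]
    push_cast
    linarith
  let center (k : Fin d → Fin N) : EuclideanSpace ℝ (Fin d) :=
    WithLp.toLp 2 fun i => gridPoint A N (k i)
  refine ⟨Finset.univ.image center, ?_, ?_, fun t ht => ?_⟩
  · intro u hu
    obtain ⟨k, -, rfl⟩ := Finset.mem_image.1 (Finset.mem_coe.1 hu)
    exact fun i => gridPoint_mem_Icc hA'.le (k i)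
  · exact Finset.card_image_le.trans (by simp)
  · choose k hk using fun i => exists_abs_gridPoint_sub_le hA' hNpos (ht i)
    refine ⟨center k, Finset.mem_image_of_mem _ (Finset.mem_univ k), ?_⟩
    have hnorm : ‖center k - t‖ ≤ Real.sqrt d * (A / N) := by
      simpa using EuclideanSpace.norm_le_sqrt_card_mul (center k - t) (by positivity) hk
    rw [Real.sqrt_le_left hε.le]
    have hNpos' : (0 : ℝ) < N := by exact_mod_cast hNpos
    have hxε : x * ε ^ 2 = A * (M / 2) * Real.sqrt d := by
      rw [hx, hc]
      field_simp
    calc (1 / 2) * ∫ s, |⟪(s : EuclideanSpace ℝ (Fin d)), center k - t⟫| ∂μ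
        ≤ (1 / 2) * (‖center k - t‖ * M) := by
          gcongr
          exact integral_abs_inner_sphere_le μ _
      _ ≤ (1 / 2) * (Real.sqrt d * (A / N) * M) := by gcongr
      _ = x * ε ^ 2 / N := by rw [hxε]; ring
      _ ≤ ε ^ 2 := by
          rw [div_le_iff₀ hNpos', mul_comm]
          gcongr
end

section
/- For every real b > 0, lim_{η→0⁺} [ ∫_0^η ( log(1 + b/ε²) )^{1/2} dε ] / [ η (2 log(1/η))^{1/2} ] = 1. -/
open MeasureTheory Filter Set

/-- The integrand is at most `√A + (log η - log ε) / √A` with `A = log (1 + b) + 2 log (1 / η)`: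
this is the tangent line bound for the square root at `A`. -/
lemma sqrt_log_one_add_div_sq_le {b η ε : ℝ} (hb : 0 < b) (hη : η < 1) (hε : 0 < ε)
    (hle : ε ≤ η) :
    Real.sqrt (Real.log (1 + b / ε ^ 2)) ≤
      Real.sqrt (Real.log (1 + b) + 2 * Real.log (1 / η)) +
        (Real.log η - Real.log ε) / Real.sqrt (Real.log (1 + b) + 2 * Real.log (1 / η)) := by
  have hη0 : 0 < η := hε.trans_le hle
  set A := Real.log (1 + b) + 2 * Real.log (1 / η) with hA
  have hApos : 0 < A :=
    add_pos (Real.log_pos (by linarith))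
      (mul_pos two_pos (Real.log_pos ((one_lt_div hη0).2 hη)))
  have hs : 0 < Real.sqrt A := Real.sqrt_pos.2 hApos
  have hlog : Real.log (1 + b / ε ^ 2) ≤ A + 2 * (Real.log η - Real.log ε) := by
    have h1 : 1 + b / ε ^ 2 ≤ (1 + b) / ε ^ 2 := by
      rw [add_div]
      gcongr
      rw [le_div_iff₀ (by positivity)]
      nlinarith
    calc Real.log (1 + b / ε ^ 2) ≤ Real.log ((1 + b) / ε ^ 2) :=
          Real.log_le_log (by positivity) h1
      _ = A + 2 * (Real.log η - Real.log ε) := by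
          rw [hA, Real.log_div (by positivity) (by positivity), Real.log_pow, one_div,
            Real.log_inv]
          push_cast
          ring
  have ht : 0 ≤ Real.log η - Real.log ε := sub_nonneg.2 (Real.log_le_log hε hle)
  apply Real.sqrt_le_iff.2
  refine ⟨by positivity, hlog.trans ?_⟩
  rw [add_sq, Real.sq_sqrt hApos.le]
  have : 2 * Real.sqrt A * ((Real.log η - Real.log ε) / Real.sqrt A) =
      2 * (Real.log η - Real.log ε) := by
    field_simp
  rw [this]
  linarith [sq_nonneg ((Real.log η - Real.log ε) / Real.sqrt A)]

lemma intervalIntegrable_sqrt_log_one_add_div_sq {b η : ℝ} (hb : 0 < b) (hη0 : 0 < η)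
    (hη : η < 1) :
    IntervalIntegrable (fun ε : ℝ => Real.sqrt (Real.log (1 + b / ε ^ 2))) volume 0 η := by
  have hmaj : IntervalIntegrable (fun ε : ℝ =>
      Real.sqrt (Real.log (1 + b) + 2 * Real.log (1 / η)) +
        (Real.log η - Real.log ε) / Real.sqrt (Real.log (1 + b) + 2 * Real.log (1 / η)))
      volume 0 η :=
    intervalIntegrable_const.add
      ((intervalIntegrable_const.sub intervalIntegral.intervalIntegrable_log').div_const _)
  refine hmaj.mono_fun (Measurable.aestronglyMeasurable (by fun_prop)) ?_
  rw [uIoc_of_le hη0.le]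
  filter_upwards [ae_restrict_mem measurableSet_Ioc] with ε hε
  rw [Real.norm_of_nonneg (Real.sqrt_nonneg _)]
  exact (sqrt_log_one_add_div_sq_le hb hη hε.1 hε.2).trans (le_abs_self _)

lemma mul_sqrt_log_le_integral {b η : ℝ} (hb : 0 < b) (hη0 : 0 < η) (hη : η < 1) :
    η * Real.sqrt (Real.log (1 + b / η ^ 2)) ≤
      ∫ ε in (0 : ℝ)..η, Real.sqrt (Real.log (1 + b / ε ^ 2)) := by
  have h := intervalIntegral.integral_mono_on_of_le_Ioo hη0.le
    (intervalIntegrable_const (c := Real.sqrt (Real.log (1 + b / η ^ 2))))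
    (intervalIntegrable_sqrt_log_one_add_div_sq hb hη0 hη) (fun ε hε => by
      have h0 : 0 < ε := hε.1
      have h1 : ε ≤ η := hε.2.le
      gcongr)
  simpa using h

lemma integral_sqrt_log_le {b η : ℝ} (hb : 0 < b) (hη0 : 0 < η) (hη : η < 1) :
    ∫ ε in (0 : ℝ)..η, Real.sqrt (Real.log (1 + b / ε ^ 2)) ≤
      η * (Real.sqrt (Real.log (1 + b) + 2 * Real.log (1 / η)) +
        1 / Real.sqrt (Real.log (1 + b) + 2 * Real.log (1 / η))) := by
  set s := Real.sqrt (Real.log (1 + b) + 2 * Real.log (1 / η)) with hs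
  have hi : IntervalIntegrable (fun ε : ℝ => (Real.log η - Real.log ε) / s) volume 0 η :=
    (intervalIntegrable_const.sub intervalIntegral.intervalIntegrable_log').div_const _
  have h := intervalIntegral.integral_mono_on_of_le_Ioo hη0.le
    (intervalIntegrable_sqrt_log_one_add_div_sq hb hη0 hη)
    ((intervalIntegrable_const (c := s)).add hi)
    (fun ε hε => sqrt_log_one_add_div_sq_le hb hη hε.1 hε.2.le)
  refine h.trans_eq ?_
  rw [intervalIntegral.integral_add intervalIntegrable_const hi,
    intervalIntegral.integral_div, intervalIntegral.integral_sub intervalIntegrable_const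
      intervalIntegral.intervalIntegrable_log', integral_log]
  simp
  ring

lemma tendsto_two_mul_log_one_div :
    Tendsto (fun η : ℝ => 2 * Real.log (1 / η)) (nhdsWithin 0 (Ioi 0)) atTop := by
  simp only [one_div]
  exact (Real.tendsto_log_atTop.comp tendsto_inv_nhdsGT_zero).const_mul_atTop two_pos

/-- `√((c + x) / x) → 1` along any filter on which `c` converges and `x → ∞`. -/
lemma tendsto_sqrt_add_div_sqrt {ι : Type*} {l : Filter ι} {c x : ι → ℝ} {a : ℝ}
    (hc : Tendsto c l (nhds a)) (hx : Tendsto x l atTop) :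
    Tendsto (fun i => Real.sqrt (c i + x i) / Real.sqrt (x i)) l (nhds 1) := by
  have h : Tendsto (fun i => Real.sqrt (c i / x i + 1)) l (nhds 1) := by
    simpa using ((hc.div_atTop hx).add_const 1).sqrt
  refine h.congr' ?_
  filter_upwards [hx.eventually_gt_atTop 0] with i hi
  rw [← Real.sqrt_div' _ hi.le, add_div, div_self hi.ne']

/-- Asymptotics of the Dudley entropy integral:
`∫_0^η √(log(1 + b/ε²)) dε ∼ η √(2 log(1/η))` as `η → 0⁺`. -/
theorem stmt15 (b : ℝ) (hb : 0 < b) :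
    Tendsto
      (fun η : ℝ =>
        (∫ ε in Set.Ioo (0 : ℝ) η, Real.sqrt (Real.log (1 + b / ε ^ 2))) /
          (η * Real.sqrt (2 * Real.log (1 / η))))
      (nhdsWithin 0 (Set.Ioi (0 : ℝ))) (nhds 1) := by
  have hx := tendsto_two_mul_log_one_div
  have hmem : ∀ᶠ η : ℝ in nhdsWithin 0 (Ioi 0), η ∈ Ioo (0 : ℝ) 1 :=
    Ioo_mem_nhdsGT one_pos
  have hlower : Tendsto (fun η : ℝ => Real.sqrt (Real.log (η ^ 2 + b) + 2 * Real.log (1 / η)) /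
      Real.sqrt (2 * Real.log (1 / η))) (nhdsWithin 0 (Ioi 0)) (nhds 1) := by
    refine tendsto_sqrt_add_div_sqrt (a := Real.log (0 ^ 2 + b)) ?_ hx
    refine Tendsto.mono_left ?_ nhdsWithin_le_nhds
    exact ((tendsto_id.pow 2).add_const b).log (by positivity)
  have hupper : Tendsto (fun η : ℝ =>
      Real.sqrt (Real.log (1 + b) + 2 * Real.log (1 / η)) / Real.sqrt (2 * Real.log (1 / η)) +
        1 / Real.sqrt (Real.log (1 + b) + 2 * Real.log (1 / η)) /
          Real.sqrt (2 * Real.log (1 / η))) (nhdsWithin 0 (Ioi 0)) (nhds 1) := by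
    have hA := Real.tendsto_sqrt_atTop.comp (tendsto_atTop_add_const_left _ (Real.log (1 + b)) hx)
    have h := (tendsto_sqrt_add_div_sqrt (tendsto_const_nhds (x := Real.log (1 + b))) hx).add
      (((tendsto_const_nhds (x := (1 : ℝ))).div_atTop hA).div_atTop
        (Real.tendsto_sqrt_atTop.comp hx))
    rwa [add_zero] at h
  refine tendsto_of_tendsto_of_tendsto_of_le_of_le' hlower hupper ?_ ?_
  · filter_upwards [hmem] with η ⟨h0, h1⟩
    have hlog : Real.log (η ^ 2 + b) + 2 * Real.log (1 / η) = Real.log (1 + b / η ^ 2) := by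
      have : 1 + b / η ^ 2 = (η ^ 2 + b) / η ^ 2 := by field_simp
      rw [this, Real.log_div (x := η ^ 2 + b) (by positivity) (by positivity), Real.log_pow, one_div, Real.log_inv]
      push_cast
      ring
    rw [← integral_Ioc_eq_integral_Ioo, ← intervalIntegral.integral_of_le h0.le, hlog,
      ← mul_div_mul_left _ (Real.sqrt (2 * Real.log (1 / η))) h0.ne']
    gcongr
    exact mul_sqrt_log_le_integral hb h0 h1
  · filter_upwards [hmem] with η ⟨h0, h1⟩
    rw [← integral_Ioc_eq_integral_Ioo, ← intervalIntegral.integral_of_le h0.le, ← add_div,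
      ← mul_div_mul_left _ (Real.sqrt (2 * Real.log (1 / η))) h0.ne']
    gcongr
    exact integral_sqrt_log_le hb h0 h1
end
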